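/- Let m = 2^s + t, where s ≥ 1 is an integer and t ∈ {−1, 0, 1}. Let d ≥ 1 be an integer and let n ≥ d + ⌈3m/2⌉ + 2. Let F be a family of nonempty subsets of [n] with χ(KG^4(F)) ≤ m. Then for any continuous map f : Δ_{n−1} → ℝ^d there exist two Radon pairs (σ⁺, σ⁻) and (τ⁺, τ⁻) for f such that none of the four intersections σ⁺ ∩ τ⁺, σ⁺ ∩ τ⁻, σ⁻ ∩ τ⁺, σ⁻ ∩ τ⁻ contains a set from F. -/

import Mathlib

/-- The face `Δ_σ` of the standard simplex spanned by the vertices in `σ`. -/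
def simplexFace {n : ℕ} (σ : Finset (Fin n)) : Set (Fin n → ℝ) :=
  {x | x ∈ stdSimplex ℝ (Fin n) ∧ ∀ i, i ∉ σ → x i = 0}

/-- `(σp, σm)` is a Radon pair for `f`: the faces are disjoint and their images intersect. -/
def IsRadonPair {n d : ℕ} (f : (Fin n → ℝ) → EuclideanSpace ℝ (Fin d))
    (σp σm : Finset (Fin n)) : Prop :=
  Disjoint σp σm ∧ (f '' simplexFace σp ∩ f '' simplexFace σm).Nonempty

/-- `χ(KG^r(F)) ≤ m`: `F` can be colored with `m` colors so that no color class contains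
`r` pairwise disjoint members. -/
def KneserChromaticLe {n : ℕ} (F : Finset (Finset (Fin n))) (r m : ℕ) : Prop :=
  ∃ c : Finset (Fin n) → Fin m, ∀ G ⊆ F,
    (∀ A ∈ G, ∀ B ∈ G, A ≠ B → Disjoint A B) →
    (∀ A ∈ G, ∀ B ∈ G, c A = c B) → G.card < r


set_option linter.unusedSimpArgs false

/-- sign `(-1)^i` -/
def sg (i : ℤ) : ℤ := if Even i then 1 else -1

lemma sg_zero : sg 0 = 1 := by simp [sg]
lemma sg_one : sg 1 = -1 := by simp [sg]
lemma sg_add (i j : ℤ) : sg (i + j) = sg i * sg j := by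
  unfold sg; by_cases hi : Even i <;> by_cases hj : Even j <;> simp [hi, hj, Int.even_add]
lemma sg_neg (i : ℤ) : sg (-i) = sg i := by simp [sg]
lemma sg_sub (i j : ℤ) : sg (i - j) = sg i * sg j := by rw [sub_eq_add_neg, sg_add, sg_neg]
lemma sg_cases (i : ℤ) : sg i = 1 ∨ sg i = -1 := by unfold sg; split_ifs <;> simp
lemma sg_mul_self (i : ℤ) : sg (i * i) = sg i := by
  unfold sg; by_cases hi : Even i <;> simp [hi, Int.even_mul]

/-- the operators used for peeling one level of labels -/
structure Ops (C : Type*) [AddCommGroup C] where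
  K : AddSubgroup C
  K' : AddSubgroup C
  one : C
  D : C →+ C
  E1 : C →+ C
  E2 : C →+ C
  T : C →+ C
  R : C →+ C
  XP : C →+ C
  XM : C →+ C
  YP : C →+ C
  YM : C →+ C
  DR : ∀ c, D (R c) = R (D c) - R (XP c) - R (XM c) - R (YP c) - R (YM c)
  DXP : ∀ c, D (XP c) = - XP (D c)
  DYP : ∀ c, D (YP c) = - YP (D c)
  DE1 : ∀ c, D (E1 c) = E1 (D c)
  DE2 : ∀ c, D (E2 c) = E2 (D c)
  RE1 : ∀ c, R (E1 c) = E1 (R c)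
  RE2 : ∀ c, R (E2 c) = E2 (R c)
  E11 : ∀ c, E1 (E1 c) = c
  E22 : ∀ c, E2 (E2 c) = c
  E21 : ∀ c, E2 (E1 c) = E1 (E2 c)
  XPE1 : ∀ c, XP (E1 c) = E1 (XM c)
  XME1 : ∀ c, XM (E1 c) = E1 (XP c)
  YPE1 : ∀ c, YP (E1 c) = E1 (YP c)
  YME1 : ∀ c, YM (E1 c) = E1 (YM c)
  XPE2 : ∀ c, XP (E2 c) = E2 (XP c)
  XME2 : ∀ c, XM (E2 c) = E2 (XM c)
  YPE2 : ∀ c, YP (E2 c) = E2 (YM c)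
  YME2 : ∀ c, YM (E2 c) = E2 (YP c)
  YX : ∀ c, YP (XP c) = - XP (YP c)
  YXM : ∀ c, YP (XM c) = - XM (YP c)
  YMX : ∀ c, YM (XP c) = - XP (YM c)
  XX : ∀ c, XP (XP c) = 0
  YY : ∀ c, YP (YP c) = 0
  TE1 : ∀ c, T (E1 c) = E2 (T c)
  TE2 : ∀ c, T (E2 c) = E1 (T c)
  TR : ∀ c, T (R c) = R (T c)
  TT : ∀ c, T (T c) = c
  TD : ∀ c, T (D c) = D (T c)
  TXP : ∀ c, T (XP c) = YP (T c)
  TXM : ∀ c, T (XM c) = YM (T c)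
  TYP : ∀ c, T (YP c) = XP (T c)
  TYM : ∀ c, T (YM c) = XM (T c)
  R1 : R one = one
  E1o : E1 one = one
  E2o : E2 one = one
  XPo : XP one = 0
  YPo : YP one = 0
  KX : ∀ c ∈ K, XM (XP c) = 0
  KY : ∀ c ∈ K, YM (YP c) = 0
  K1 : ∀ c ∈ K', E1 c ∈ K'
  K2 : ∀ c ∈ K', E2 c ∈ K'
  KR : ∀ c ∈ K, R c ∈ K'
  KXP : ∀ c ∈ K, XP c ∈ K
  KYP : ∀ c ∈ K, YP c ∈ K

namespace Ops
variable {C : Type*} [AddCommGroup C] (O : Ops C)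

/-- a family of chains `z i j` with all symmetry relations -/
structure Fam (K : AddSubgroup C) (one : C) (D E1 E2 T : C →+ C) (N : ℤ) (z : ℤ → ℤ → C) : Prop where
  rel : ∀ i j, i ≤ N → j ≤ N → D (z i j) =
    z (i-1) j + sg i • E1 (z (i-1) j) + sg i • (z i (j-1) + sg j • E2 (z i (j-1)))
      + if i = 0 ∧ j = 0 then one else 0
  symm : ∀ i j, z j i = sg (i * j) • T (z i j)
  mem : ∀ i j, z i j ∈ K
  half : ∀ i, 1 ≤ i → i ≤ N → ∃ W ∈ K, ∃ b, z i i = W + sg i • T W ∧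
    D W = z (i-1) i + sg i • E1 (z (i-1) i) + (b - sg i • T b)

/-- peeling -/
def peel (z : ℤ → ℤ → C) (i j : ℤ) : C :=
  - sg j • O.R (O.XP (O.YP (z (i+1) (j+1)))) + sg i • O.E2 (O.R (O.XP (z (i+1) j)))
  + (sg i * sg j) • O.E1 (O.R (O.YP (z i (j+1)))) + O.E1 (O.E2 (O.R (z i j)))

lemma peel_rel {N : ℤ} {z : ℤ → ℤ → C} (h : Fam O.K O.one O.D O.E1 O.E2 O.T (N+1) z)
    (i j : ℤ) (hi : i ≤ N) (hj : j ≤ N) : O.D (O.peel z i j) =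
    O.peel z (i-1) j + sg i • O.E1 (O.peel z (i-1) j) +
      sg i • (O.peel z i (j-1) + sg j • O.E2 (O.peel z i (j-1)))
      + if i = 0 ∧ j = 0 then O.one else 0 := by
  have h1 := h.rel (i+1) (j+1) (by omega) (by omega)
  have h2 := h.rel (i+1) j (by omega) (by omega)
  have h3 := h.rel i (j+1) (by omega) (by omega)
  have h4 := h.rel i j (by omega) (by omega)
  have kx : ∀ i j, O.XM (O.XP (z i j)) = 0 := fun i j => O.KX _ (h.mem i j)
  have ky : ∀ i j, O.YM (O.YP (z i j)) = 0 := fun i j => O.KY _ (h.mem i j)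
  have kxy : ∀ i j, O.XM (O.XP (O.YP (z i j))) = 0 := fun i j => O.KX _ (O.KYP _ (h.mem i j))
  have kyx : ∀ i j, O.XP (O.YM (O.YP (z i j))) = 0 := fun i j => by rw [ky]; simp
  have o1 : O.YP (if i + 1 = 0 ∧ j + 1 = 0 then O.one else 0) = 0 := by split_ifs <;> simp [O.YPo]
  have o2 : O.XP (if i + 1 = 0 ∧ j = 0 then O.one else 0) = 0 := by split_ifs <;> simp [O.XPo]
  have o3 : O.YP (if i = 0 ∧ j + 1 = 0 then O.one else 0) = 0 := by split_ifs <;> simp [O.YPo]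
  have o4 : O.E1 (O.E2 (O.R (if i = 0 ∧ j = 0 then O.one else 0))) = if i = 0 ∧ j = 0 then O.one else 0 := by
    split_ifs <;> simp [O.R1, O.E1o, O.E2o]
  simp only [peel, map_add, map_neg, map_zsmul, O.DE1, O.DE2, O.DR, O.DXP, O.DYP, map_sub, h1, h2, h3, h4, o1, o2, o3, o4]
  generalize (if i = 0 ∧ j = 0 then O.one else 0) = oo
  simp only [sg_add, sg_sub, sg_one, add_sub_cancel_right, sub_add_cancel]
  rcases sg_cases i with hi | hi <;> rcases sg_cases j with hj | hj <;> rw [hi, hj] <;>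
  simp only [map_add, map_neg, map_zsmul, O.RE1, O.RE2, O.E11, O.E22, O.E21, O.XPE1, O.XME1, O.YPE1, O.YME1,
    O.XPE2, O.XME2, O.YPE2, O.YME2, O.YX, O.YXM, O.YMX, O.XX, O.YY, kx, ky, kxy, kyx, map_zero, neg_zero,
    mul_one, mul_neg, neg_mul, neg_neg, neg_smul, one_smul, map_sub, smul_add, smul_neg] <;> abel

lemma peel_symm {N : ℤ} {z : ℤ → ℤ → C} (h : Fam O.K O.one O.D O.E1 O.E2 O.T (N+1) z)
    (i j : ℤ) : O.peel z j i = sg (i * j) • O.T (O.peel z i j) := by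
  have h1 := h.symm (i+1) (j+1)
  have h2 := h.symm i (j+1)
  have h3 := h.symm (i+1) j
  have h4 := h.symm i j
  have e1 : sg ((i+1)*(j+1)) = - (sg (i*j) * sg i * sg j) := by
    rw [show (i+1)*(j+1) = i*j+i+j+1 by ring]; simp [sg_add, sg_one]
  have e2 : sg (i*(j+1)) = sg (i*j) * sg i := by
    rw [show i*(j+1) = i*j+i by ring]; simp [sg_add]
  have e3 : sg ((i+1)*j) = sg (i*j) * sg j := by
    rw [show (i+1)*j = i*j+j by ring]; simp [sg_add]
  simp only [peel, h1, h2, h3, h4, e1, e2, e3]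
  rcases sg_cases i with hi | hi <;> rcases sg_cases j with hj | hj <;>
   rcases sg_cases (i*j) with hij | hij <;> rw [hi, hj, hij] <;>
  simp only [map_add, map_neg, map_zsmul, O.TE1, O.TE2, O.TR, O.TXP, O.TYP, O.YX, O.E21,
    mul_one, mul_neg, neg_mul, neg_neg, neg_smul, one_smul, smul_add, smul_neg] <;> abel

lemma peel_mem {N : ℤ} {z : ℤ → ℤ → C} (h : Fam O.K O.one O.D O.E1 O.E2 O.T (N+1) z)
    (i j : ℤ) : O.peel z i j ∈ O.K' := by
  unfold peel
  refine add_mem (add_mem (add_mem ?_ ?_) ?_) ?_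
  · exact zsmul_mem (O.KR _ (O.KXP _ (O.KYP _ (h.mem _ _)))) _
  · exact zsmul_mem (O.K2 _ (O.KR _ (O.KXP _ (h.mem _ _)))) _
  · exact zsmul_mem (O.K1 _ (O.KR _ (O.KYP _ (h.mem _ _)))) _
  · exact O.K1 _ (O.K2 _ (O.KR _ (h.mem _ _)))

set_option maxHeartbeats 2000000 in
lemma peel_half {N : ℤ} {z : ℤ → ℤ → C} (h : Fam O.K O.one O.D O.E1 O.E2 O.T (N+1) z)
    (i : ℤ) (hi : 1 ≤ i) (hi' : i ≤ N) : ∃ W ∈ O.K', ∃ b, O.peel z i i = W + sg i • O.T W ∧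
    O.D W = O.peel z (i-1) i + sg i • O.E1 (O.peel z (i-1) i) + (b - sg i • O.T b) := by
  obtain ⟨W, hW, b, hb1, hb2⟩ := h.half i hi (by omega)
  obtain ⟨V, hV, d, hd1, hd2⟩ := h.half (i+1) (by omega) (by omega)
  have hs : z (i+1) i = O.T (z i (i+1)) := by
    rw [h.symm i (i+1), show i*(i+1) = i*i+i by ring, sg_add, sg_mul_self]
    rcases sg_cases i with hh | hh <;> simp [hh]
  have h3 := h.rel i (i+1) (by omega) (by omega)
  have kx : ∀ i j, O.XM (O.XP (z i j)) = 0 := fun i j => O.KX _ (h.mem i j)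
  have ky : ∀ i j, O.YM (O.YP (z i j)) = 0 := fun i j => O.KY _ (h.mem i j)
  have kxy : ∀ i j, O.XM (O.XP (O.YP (z i j))) = 0 := fun i j => O.KX _ (O.KYP _ (h.mem i j))
  have kyx : ∀ i j, O.XP (O.YM (O.YP (z i j))) = 0 := fun i j => by rw [ky]; simp
  have vx : O.XM (O.XP (O.YP V)) = 0 := O.KX _ (O.KYP _ hV)
  have vy : O.YM (O.YP V) = 0 := (O.KY _ hV)
  have o3 : (if i = 0 ∧ i + 1 = 0 then O.one else 0) = 0 := by
    rw [if_neg]; omega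
  refine ⟨- sg i • O.R (O.XP (O.YP V)) + O.E1 (O.R (O.YP (z i (i+1)))) + O.E1 (O.E2 (O.R W)),
    add_mem (add_mem (zsmul_mem (O.KR _ (O.KXP _ (O.KYP _ hV))) _)
      (O.K1 _ (O.KR _ (O.KYP _ (h.mem _ _))))) (O.K1 _ (O.K2 _ (O.KR _ hW))), 
    - sg i • O.R (O.XP (O.YP d)) + O.E1 (O.E2 (O.R b))
    - O.E1 (O.E2 (O.R (O.XM W))) - O.E1 (O.E2 (O.R (O.YP W)))
    + sg i • O.E2 (O.R (O.XP W)) - sg i • O.E1 (O.R (O.YP W)), ?_, ?_⟩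
  · simp only [peel, hb1, hd1, hs, sg_add, sg_one]
    rcases sg_cases i with hi | hi <;> rw [hi] <;>
    simp only [map_add, map_neg, map_zsmul, O.TE1, O.TE2, O.TR, O.TXP, O.TYP, O.YX, O.E21,
      mul_one, mul_neg, neg_mul, neg_neg, neg_smul, one_smul, smul_add, smul_neg] <;> abel
  · simp only [peel, map_add, map_neg, map_zsmul, O.DE1, O.DE2, O.DR, O.DXP, O.DYP, map_sub, hb2, hd2, h3, o3]
    simp only [sg_add, sg_sub, sg_one, add_sub_cancel_right, sub_add_cancel, hb1, hd1, hs]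
    rcases sg_cases i with hi | hi <;> rw [hi] <;>
    simp only [map_add, map_neg, map_zsmul, O.RE1, O.RE2, O.E11, O.E22, O.E21, O.XPE1, O.XME1, O.YPE1, O.YME1,
      O.XPE2, O.XME2, O.YPE2, O.YME2, O.YX, O.YXM, O.YMX, O.XX, O.YY, kx, ky, kxy, kyx, vx, vy, map_zero, neg_zero,
      O.TE1, O.TE2, O.TR, O.TXP, O.TYP, O.TXM, O.TYM, O.TT,
      mul_one, mul_neg, neg_mul, neg_neg, neg_smul, one_smul, map_sub, smul_add, smul_neg, smul_sub] <;> abel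

lemma peel_fam {N : ℤ} {z : ℤ → ℤ → C} (h : Fam O.K O.one O.D O.E1 O.E2 O.T (N+1) z) :
    Fam O.K' O.one O.D O.E1 O.E2 O.T N (O.peel z) :=
  ⟨O.peel_rel h, O.peel_symm h, O.peel_mem h, O.peel_half h⟩
end Ops

set_option linter.unusedSimpArgs false

/-- labels -/
inductive Lb where
  | x (l : ℕ) (s : Bool) : Lb
  | y (l : ℕ) (s : Bool) : Lb
  | c (l : ℕ) (s : Bool) : Lb

noncomputable instance : DecidableEq Lb := Classical.decEq _

namespace Lb

/-- flip all signs -/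
def neg : Lb → Lb
  | x l s => x l (!s)
  | y l s => y l (!s)
  | c l s => c l (!s)

/-- first antipode -/
def f1 : Lb → Lb
  | x l s => x l (!s)
  | y l s => y l s
  | c l s => c l (!s)

/-- second antipode -/
def f2 : Lb → Lb
  | x l s => x l s
  | y l s => y l (!s)
  | c l s => c l (!s)

/-- swap -/
def tw : Lb → Lb
  | x l s => y l s
  | y l s => x l s
  | c l s => c l s

/-- labels kept when bounding -/
def kp (a b : ℕ) : Lb → Prop
  | x l _ => l < a
  | y l _ => l < a
  | c l _ => l < b

end Lb

noncomputable section
open Classical in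
/-- restrict a relabelling to a set of labels -/
def rst (A : Lb → Prop) (l : Lb) : Option Lb := if A l then some l else none

abbrev MM := Lb →₀ ℤ
abbrev LL := ExteriorAlgebra ℤ MM

/-- linear map induced by a partial relabelling -/
def lin (g : Lb → Option Lb) : MM →ₗ[ℤ] MM :=
  Finsupp.linearCombination ℤ (fun l => (g l).elim 0 (fun l' => Finsupp.single l' 1))

/-- algebra map induced by a partial relabelling -/
def mp (g : Lb → Option Lb) : LL →ₐ[ℤ] LL := ExteriorAlgebra.map (lin g)

/-- functional -/
def fn (w : Lb → ℤ) : Module.Dual ℤ MM := Finsupp.linearCombination ℤ w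

/-- contraction -/
def cd (w : Lb → ℤ) : LL →ₗ[ℤ] LL := CliffordAlgebra.contractLeft (fn w)

/-- generator -/
def gen (l : Lb) : LL := ExteriorAlgebra.ι ℤ (Finsupp.single l 1)

def pull (g : Lb → Option Lb) (w : Lb → ℤ) (l : Lb) : ℤ := (g l).elim 0 w

/-- indicator -/
def dl (l : Lb) : Lb → ℤ := fun l' => if l' = l then 1 else 0

lemma ind (P : LL → Prop) (h1 : P 1) (hadd : ∀ a b, P a → P b → P (a+b))
    (hs : ∀ (r : ℤ) a, P a → P (r • a)) (hm : ∀ l a, P a → P (gen l * a)) (a : LL) : P a := by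
  refine CliffordAlgebra.left_induction (Q := (0 : QuadraticForm ℤ MM)) (P := P) ?_ ?_ ?_ a
  · intro r
    rw [Algebra.algebraMap_eq_smul_one]; exact hs _ _ h1
  · exact hadd
  · intro x m hx
    induction m using Finsupp.induction_linear with
    | zero => rw [map_zero, zero_mul]; simpa using hs 0 1 h1
    | add f g hf hg => rw [map_add, add_mul]; exact hadd _ _ hf hg
    | single l r =>
      have : (Finsupp.single l r : MM) = r • Finsupp.single l 1 := by simp
      rw [this, map_smul, smul_mul_assoc]
      exact hs _ _ (hm l _ hx)

@[simp] lemma cd_one (w) : cd w 1 = 0 := by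
  unfold cd; exact CliffordAlgebra.contractLeft_one (Q := (0 : QuadraticForm ℤ MM)) _
lemma cd_gen_mul (w l a) : cd w (gen l * a) = w l • a - gen l * cd w a := by
  unfold cd gen
  have := CliffordAlgebra.contractLeft_ι_mul (Q := (0 : QuadraticForm ℤ MM)) (d := fn w) (Finsupp.single l 1) a
  rw [show (fn w) (Finsupp.single l 1) = w l by simp [fn]] at this
  exact this
lemma cd_comm (w w' a) : cd w (cd w' a) = - cd w' (cd w a) := by
  unfold cd; exact CliffordAlgebra.contractLeft_comm _ _ _
@[simp] lemma cd_cd (w a) : cd w (cd w a) = 0 := by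
  unfold cd; exact CliffordAlgebra.contractLeft_contractLeft _ _
@[simp] lemma cd_zero : cd 0 = 0 := by
  unfold cd
  rw [show fn 0 = 0 by ext; simp [fn], map_zero]
lemma cd_add (w w' a) : cd (w + w') a = cd w a + cd w' a := by
  unfold cd
  rw [show fn (w+w') = fn w + fn w' by ext; simp [fn], map_add, LinearMap.add_apply]
lemma cd_neg (w a) : cd (-w) a = - cd w a := by
  unfold cd
  rw [show fn (-w) = - fn w by ext; simp [fn], map_neg, LinearMap.neg_apply]

lemma mp_gen (g l) : mp g (gen l) = (g l).elim 0 gen := by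
  unfold mp gen
  rw [ExteriorAlgebra.map_apply_ι]
  simp only [lin, Finsupp.linearCombination_single, one_smul]
  cases g l <;> simp

lemma cd_mp (g w a) : cd w (mp g a) = mp g (cd (pull g w) a) := by
  induction a using ind with
  | h1 => simp
  | hadd a b ha hb => simp [ha, hb]
  | hs r a ha => rw [map_smul, map_smul, map_smul, map_smul, ha]
  | hm l a ha =>
    rw [cd_gen_mul, map_sub, map_smul, map_mul (mp g), map_mul (mp g), mp_gen, ← ha, pull]
    cases g l with
    | none => simp
    | some l' => simp [cd_gen_mul]

lemma mp_mp (g g' a) : mp g (mp g' a) = mp (fun l => (g' l).bind g) a := by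
  induction a using ind with
  | h1 => simp
  | hadd a b ha hb => simp [ha, hb]
  | hs r a ha => simp [ha]
  | hm l a ha =>
    simp only [map_mul, ha, mp_gen]
    cases g' l with
    | none => simp
    | some l' => simp [mp_gen]

lemma mp_some (a) : mp some a = a := by
  induction a using ind with
  | h1 => simp
  | hadd a b ha hb => simp [ha, hb]
  | hs r a ha => simp [ha]
  | hm l a ha => simp [ha, mp_gen]

/-- antipode-free elements -/
def KK : AddSubgroup LL where
  carrier := {a | ∀ l, cd (dl l) (cd (dl l.neg) a) = 0}
  zero_mem' := by intro l; simp
  add_mem' := by intro a b ha hb l; simp [ha l, hb l]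
  neg_mem' := by intro a ha l; simp [ha l]

lemma KK_cd {a} (h : a ∈ KK) (w) : cd w a ∈ KK := by
  intro l
  rw [cd_comm _ w, map_neg, cd_comm _ w, h l]; simp

lemma KK_mp {a} (h : a ∈ KK) (g)
    (hg : ∀ l, (∃ l', pull g (dl l) = dl l' ∧ pull g (dl l.neg) = dl l'.neg) ∨ pull g (dl l) = 0) :
    mp g a ∈ KK := by
  intro l
  rw [cd_mp, cd_mp]
  rcases hg l with ⟨l', h1, h2⟩ | h1
  · rw [h1, h2, h l', map_zero]
  · rw [h1]; simp

/-- elements supported on labels in `A` -/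
def Sup (A : Lb → Prop) (a : LL) : Prop := mp (rst A) a = a

lemma Sup_KK {A : Lb → Prop} (hA : ∀ l, A l → ¬ A l.neg) {a} (h : Sup A a) : a ∈ KK := by
  intro l
  have h0 : ∀ l, ¬ A l → pull (rst A) (dl l) = 0 := by
    intro l hl; funext l'
    simp only [pull, rst]
    split_ifs with h
    · simp [dl]; rintro rfl; exact hl h
    · simp
  rw [← h, cd_mp, cd_mp]
  by_cases hl : A l
  · rw [h0 _ (hA l hl)]; simp
  · rw [h0 _ hl]; simp

lemma Sup_one (A) : Sup A 1 := by simp [Sup]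
lemma Sup_add {A a b} (ha : Sup A a) (hb : Sup A b) : Sup A (a+b) := by simp_all [Sup]
lemma Sup_zero (A) : Sup A 0 := by simp [Sup]
lemma Sup_smul {A a} (r : ℤ) (ha : Sup A a) : Sup A (r • a) := by simp_all [Sup]
lemma Sup_mul {A a b} (ha : Sup A a) (hb : Sup A b) : Sup A (a*b) := by simp_all [Sup]
lemma Sup_gen {A : Lb → Prop} {l} (h : A l) : Sup A (gen l) := by
  unfold Sup; rw [mp_gen]; simp [rst, h]

lemma Sup_cd {A a} (ha : Sup A a) (w) : Sup A (cd w a) := by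
  have h1 : rst A = fun l => (rst A l).bind (rst A) := by
    funext l; unfold rst; split_ifs with h <;> simp [h]
  have h2 : pull (rst A) (pull (rst A) w) = pull (rst A) w := by
    funext l; unfold pull rst; split_ifs with h <;> simp [h]
  unfold Sup
  conv_lhs => rw [← ha, cd_mp, mp_mp, ← h1, ← cd_mp, ha]

lemma Sup_mp {A B : Lb → Prop} {a} (ha : Sup A a) (g : Lb → Option Lb)
    (hg : ∀ l l', A l → g l = some l' → B l') : Sup B (mp g a) := by
  unfold Sup
  conv_lhs => rw [← ha]
  conv_rhs => rw [← ha]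
  rw [mp_mp, mp_mp, mp_mp]
  congr 2; funext l; unfold rst
  split_ifs with h
  · simp only [Option.bind_some]
    cases hh : g l with
    | none => simp
    | some l' => simp [hg l l' h hh]
  · simp
end

set_option linter.unusedSimpArgs false
noncomputable section

/-- total relabelling -/
def mq (g : Lb → Lb) : LL →+ LL := (mp (fun l => some (g l))).toLinearMap.toAddMonoidHom
/-- restriction to labels -/
def mr (A : Lb → Prop) : LL →+ LL := (mp (rst A)).toLinearMap.toAddMonoidHom
/-- contraction as additive map -/
def ch (w : Lb → ℤ) : LL →+ LL := (cd w).toAddMonoidHom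

lemma mq_apply (g a) : mq g a = mp (fun l => some (g l)) a := rfl
lemma mr_apply (g a) : mr g a = mp (rst g) a := rfl
lemma ch_apply (g a) : ch g a = cd g a := rfl

lemma mq_mq (g g' a) : mq g (mq g' a) = mq (g ∘ g') a := by
  simp only [mq_apply, mp_mp]; rfl

lemma mq_id (a) : mq id a = a := mp_some a

lemma mr_mq (A g a) (h : ∀ l, A (g l) ↔ A l) : mr A (mq g a) = mq g (mr A a) := by
  simp only [mq_apply, mr_apply, mp_mp]
  congr 2; funext l
  simp only [rst, Option.bind_some, h]
  split_ifs <;> simp_all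

lemma ch_mq (w g a) : ch w (mq g a) = mq g (ch (w ∘ g) a) := by
  simp only [mq_apply, ch_apply, cd_mp]; rfl

lemma ch1_mq (g a) : ch 1 (mq g a) = mq g (ch 1 a) := by
  rw [ch_mq]; rfl

lemma mq_ch (w g a) (h : ∀ l, g (g l) = l) : mq g (ch w a) = ch (w ∘ g) (mq g a) := by
  rw [ch_mq, Function.comp_assoc, show g ∘ g = id from funext h]; rfl

lemma ch_mr (w A a) : ch w (mr A a) = mr A (ch (pull (rst A) w) a) := by
  simp only [mr_apply, ch_apply, cd_mp]

lemma dl_comp (l : Lb) (g : Lb → Lb) (h : ∀ l, g (g l) = l) : dl l ∘ g = dl (g l) := by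
  funext l'
  simp only [dl, Function.comp]
  congr 1
  exact propext ⟨fun h' => by rw [← h', h], fun h' => by rw [h', h]⟩

lemma pull_rst (A : Lb → Prop) (w) (l) [Decidable (A l)] : pull (rst A) w l = if A l then w l else 0 := by
  unfold pull rst; split_ifs <;> simp

namespace Lb
lemma f11 (l : Lb) : f1 (f1 l) = l := by cases l <;> simp [f1]
lemma f22 (l : Lb) : f2 (f2 l) = l := by cases l <;> simp [f2]
lemma tt (l : Lb) : tw (tw l) = l := by cases l <;> simp [tw]
lemma nn (l : Lb) : neg (neg l) = l := by cases l <;> simp [neg]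

/-- not of level `k` -/
def nl (k : ℕ) : Lb → Prop
  | x l _ => l ≠ k
  | y l _ => l ≠ k
  | c _ _ => True
end Lb

lemma KK_mq {a} (h : a ∈ KK) (g) (hg : ∀ l, g (g l) = l) (hn : ∀ l, g (l.neg) = (g l).neg) : mq g a ∈ KK := by
  apply KK_mp h
  intro l
  left
  exact ⟨g l, dl_comp l g hg, by rw [← hn]; exact dl_comp _ g hg⟩

lemma KK_mr {a} (h : a ∈ KK) (A : Lb → Prop) (hn : ∀ l, A l.neg ↔ A l) : mr A a ∈ KK := by
  apply KK_mp h
  intro l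
  classical
  by_cases hl : A l
  · left
    refine ⟨l, ?_, ?_⟩
    · funext l'
      rw [pull_rst]; unfold dl
      split_ifs with h1 h2 h2 <;> simp_all
    · funext l'
      rw [pull_rst]; unfold dl
      split_ifs with h1 h2 h2 <;> simp_all
  · right
    funext l'
    rw [pull_rst]; unfold dl
    split_ifs with h1 h2 h2 <;> simp_all

lemma KK_ant (l : Lb) : ∀ a ∈ KK, ch (dl l) (ch (dl l.neg) a) = 0 := fun a h => h l
lemma KK_ch {a} (h : a ∈ KK) (w) : ch w a ∈ KK := KK_cd h w
lemma mq_one (g) : mq g 1 = 1 := by simp [mq_apply]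
lemma mr_one (g) : mr g 1 = 1 := by simp [mr_apply]
lemma ch_one (g) : ch g 1 = 0 := by simp [ch_apply]
lemma ch_comm (w w' a) : ch w (ch w' a) = - ch w' (ch w a) := cd_comm _ _ _
lemma ch_self (w a) : ch w (ch w a) = 0 := cd_cd _ _

lemma Sup_mq {A B : Lb → Prop} {a} (ha : Sup A a) (g : Lb → Lb) (h : ∀ l, A l → B (g l)) : Sup B (mq g a) := by
  apply Sup_mp ha
  intro l l' hl hh
  cases hh; exact h l hl

lemma Sup_mr {A B C : Lb → Prop} {a} (ha : Sup A a) (h : ∀ l, A l → C l → B l) : Sup B (mr C a) := by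
  apply Sup_mp ha
  intro l l' hl hh
  simp only [rst] at hh
  split_ifs at hh with h1
  cases hh; exact h l hl h1

/-- antipode-free bounded elements -/
def KS (a b : ℕ) : AddSubgroup LL where
  carrier := {c | c ∈ KK ∧ Sup (Lb.kp a b) c}
  zero_mem' := ⟨zero_mem _, Sup_zero _⟩
  add_mem' := fun h h' => ⟨add_mem h.1 h'.1, Sup_add h.2 h'.2⟩
  neg_mem' := fun {c} h => ⟨neg_mem h.1, by simpa using Sup_smul (-1) h.2⟩

open Lb in
/-- operators for level `k` -/
def opsL (b k : ℕ) : Ops LL where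
  K := KS (k+1) b
  K' := KS k b
  one := 1
  D := ch 1
  E1 := mq f1
  E2 := mq f2
  T := mq tw
  R := mr (nl k)
  XP := ch (dl (x k true))
  XM := ch (dl (x k false))
  YP := ch (dl (y k true))
  YM := ch (dl (y k false))
  DR := by
    intro a
    rw [ch_mr, ← map_sub, ← map_sub, ← map_sub, ← map_sub]
    congr 1
    simp only [ch_apply]
    have : (1 : Lb → ℤ) = pull (rst (nl k)) 1 + dl (x k true) + dl (x k false) + dl (y k true) + dl (y k false) := by
      classical
      funext l
      simp only [Pi.add_apply, pull_rst, Pi.one_apply, dl]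
      rcases l with ⟨l, s⟩ | ⟨l, s⟩ | ⟨l, s⟩ <;> by_cases h : l = k <;> cases s <;> simp [nl, h]
    conv_rhs => rw [this]
    simp only [cd_add]
    abel
  DXP _ := ch_comm _ _ _
  DYP _ := ch_comm _ _ _
  DE1 a := ch1_mq _ _
  DE2 a := ch1_mq _ _
  RE1 _ := mr_mq _ _ _ (by rintro (_|_|_) <;> simp [nl, f1])
  RE2 _ := mr_mq _ _ _ (by rintro (_|_|_) <;> simp [nl, f2])
  E11 a := by rw [mq_mq, show f1 ∘ f1 = id from funext f11, mq_id]
  E22 a := by rw [mq_mq, show f2 ∘ f2 = id from funext f22, mq_id]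
  E21 a := by
    rw [mq_mq, mq_mq]; congr 2; funext l; cases l <;> simp [f1, f2]
  XPE1 a := by rw [ch_mq, dl_comp _ _ f11]; rfl
  XME1 a := by rw [ch_mq, dl_comp _ _ f11]; rfl
  YPE1 a := by rw [ch_mq, dl_comp _ _ f11]; rfl
  YME1 a := by rw [ch_mq, dl_comp _ _ f11]; rfl
  XPE2 a := by rw [ch_mq, dl_comp _ _ f22]; rfl
  XME2 a := by rw [ch_mq, dl_comp _ _ f22]; rfl
  YPE2 a := by rw [ch_mq, dl_comp _ _ f22]; rfl
  YME2 a := by rw [ch_mq, dl_comp _ _ f22]; rfl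
  YX _ := ch_comm _ _ _
  YXM _ := ch_comm _ _ _
  YMX _ := ch_comm _ _ _
  XX _ := ch_self _ _
  YY _ := ch_self _ _
  TE1 a := by
    rw [mq_mq, mq_mq]; congr 2; funext l; cases l <;> simp [f1, f2, tw]
  TE2 a := by
    rw [mq_mq, mq_mq]; congr 2; funext l; cases l <;> simp [f1, f2, tw]
  TR a := (mr_mq _ _ _ (by rintro (_|_|_) <;> simp [nl, tw])).symm
  TT a := by rw [mq_mq, show tw ∘ tw = id from funext tt, mq_id]
  TD a := (ch1_mq _ _).symm
  TXP a := by rw [mq_ch _ _ _ tt, dl_comp _ _ tt]; rfl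
  TXM a := by rw [mq_ch _ _ _ tt, dl_comp _ _ tt]; rfl
  TYP a := by rw [mq_ch _ _ _ tt, dl_comp _ _ tt]; rfl
  TYM a := by rw [mq_ch _ _ _ tt, dl_comp _ _ tt]; rfl
  R1 := mr_one _
  E1o := mq_one _
  E2o := mq_one _
  XPo := ch_one _
  YPo := ch_one _
  KX c h := KK_ant (x k false) c h.1
  KY c h := KK_ant (y k false) c h.1
  K1 a h := ⟨KK_mq h.1 _ f11 (by rintro (_|_|_) <;> simp [neg, f1]),
    Sup_mq h.2 _ (by rintro (⟨l,s⟩|⟨l,s⟩|⟨l,s⟩) <;> simp [kp, f1])⟩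
  K2 a h := ⟨KK_mq h.1 _ f22 (by rintro (_|_|_) <;> simp [neg, f2]),
    Sup_mq h.2 _ (by rintro (⟨l,s⟩|⟨l,s⟩|⟨l,s⟩) <;> simp [kp, f2])⟩
  KR a h := ⟨KK_mr h.1 _ (by rintro (_|_|_) <;> simp [neg, nl]),
    Sup_mr h.2 (by rintro (⟨l,s⟩|⟨l,s⟩|⟨l,s⟩) <;> simp [kp, nl] <;> omega)⟩
  KXP a h := ⟨KK_ch h.1 _, Sup_cd h.2 _⟩
  KYP a h := ⟨KK_ch h.1 _, Sup_cd h.2 _⟩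

open Lb in
/-- the family notion for our algebra -/
abbrev FamL (a b : ℕ) (N : ℤ) (z : ℤ → ℤ → LL) : Prop :=
  Ops.Fam (KS a b) 1 (ch 1) (mq f1) (mq f2) (mq tw) N z

open Lb in
lemma peel_all (a b : ℕ) (N : ℤ) (z) (hz : FamL a b (N + a) z) :
    ∃ z', FamL 0 b N z' := by
  induction a generalizing z with
  | zero => exact ⟨z, by simpa using hz⟩
  | succ a ih =>
    refine ih _ ((opsL b a).peel_fam (N := N + a) (z := z) ?_)
    have : N + (a+1 : ℕ) = N + a + 1 := by push_cast; ring
    rw [this] at hz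
    exact hz
end

set_option linter.unusedSimpArgs false
noncomputable section
namespace Lb
/-- not the central label of index `k` -/
def nc (k : ℕ) : Lb → Prop
  | x _ _ => True
  | y _ _ => True
  | c l _ => l ≠ k
end Lb
open Lb

/-- scalar part -/
def sca : LL →+ ℤ := (ExteriorAlgebra.algebraMapInv (R := ℤ) (M := MM)).toLinearMap.toAddMonoidHom

lemma sca_one : sca 1 = 1 := map_one (ExteriorAlgebra.algebraMapInv (R := ℤ) (M := MM))
lemma sca_gen_mul (l a) : sca (gen l * a) = 0 := by
  have : sca (gen l * a) = ExteriorAlgebra.algebraMapInv (R := ℤ) (M := MM) (gen l) *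
    ExteriorAlgebra.algebraMapInv (R := ℤ) (M := MM) a := map_mul (ExteriorAlgebra.algebraMapInv (R := ℤ) (M := MM)) _ _
  rw [this]
  simp [gen, ExteriorAlgebra.algebraMapInv]

lemma sca_mp (g a) : sca (mp g a) = sca a := by
  induction a using ind with
  | h1 => simp
  | hadd a b ha hb => simp only [map_add, ha, hb]
  | hs r a ha => rw [map_smul, map_zsmul, map_zsmul, ha]
  | hm l a ha =>
    rw [map_mul, sca_gen_mul, mp_gen]
    cases g l with
    | none => simp
    | some l' => simp [sca_gen_mul]

lemma Sup_none {a} (h : Sup (kp 0 0) a) : ∃ r : ℤ, a = r • 1 := by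
  have key : ∀ a, ∃ r : ℤ, mp (rst (kp 0 0)) a = r • 1 := by
    intro a
    induction a using ind with
    | h1 => exact ⟨1, by simp⟩
    | hadd a b ha hb =>
      obtain ⟨r, hr⟩ := ha
      obtain ⟨s, hs⟩ := hb
      exact ⟨r + s, by rw [map_add, hr, hs, add_smul]⟩
    | hs t a ha =>
      obtain ⟨r, hr⟩ := ha
      exact ⟨t * r, by rw [map_smul, hr, smul_smul]⟩
    | hm l a ha =>
      refine ⟨0, ?_⟩
      rw [map_mul, mp_gen]
      have : rst (kp 0 0) l = none := by
        unfold rst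
        rw [if_neg]
        rcases l with _|_|_ <;> simp [kp]
      rw [this]; simp
  rw [← h]
  exact key a

/-- alternating sign -/
def altb (q : ℤ) : Bool := decide (Even q)
lemma altb_succ (q : ℤ) : altb (q+1) = !altb q := by
  unfold altb; simp only [Int.even_add_one, decide_not]

/-- the final functional -/
def FF : ℕ → ℤ → (LL →+ ℤ)
  | 0, q => if q = 0 then sca else 0
  | b+1, q => (FF b q).comp (mr (nc b)) + (FF b (q-1)).comp ((mr (nc b)).comp (ch (dl (c b (altb q)))))

lemma FF_succ (b q a) : FF (b+1) q a = FF b q (mr (nc b) a) + FF b (q-1) (mr (nc b) (ch (dl (c b (altb q))) a)) := rfl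
lemma FF_zero (q a) : FF 0 q a = if q = 0 then sca a else 0 := by
  simp only [FF]; split_ifs <;> rfl

lemma FF_out (b : ℕ) (q : ℤ) (h : q < 0 ∨ b < q) (a) : FF b q a = 0 := by
  induction b generalizing q a with
  | zero => rw [FF_zero, if_neg]; push_cast at h; omega
  | succ b ih => rw [FF_succ, ih, ih, add_zero] <;> push_cast at h <;> omega

lemma FF_one (b : ℕ) (q : ℤ) : FF b q 1 = if q = 0 then 1 else 0 := by
  induction b with
  | zero => rw [FF_zero, sca_one]
  | succ b ih => rw [FF_succ, mr_one, ch_one, ih]; simp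

lemma FF_mq (g : Lb → Lb) (hg : ∀ l, g (g l) = l) (hc : ∀ j s, g (c j s) = c j s) (b q a) : FF b q (mq g a) = FF b q a := by
  induction b generalizing q a with
  | zero => rw [FF_zero, FF_zero, mq_apply, sca_mp]
  | succ b ih =>
    have h1 : ∀ l, nc b (g l) ↔ nc b l := by
      intro l
      by_cases h : ∃ j s, l = c j s
      · obtain ⟨j, s, rfl⟩ := h
        rw [hc]
      · have h' : ¬ ∃ j s, g l = c j s := by
          rintro ⟨j, s, hh⟩
          apply h
          refine ⟨j, s, ?_⟩
          rw [← hg l, hh, hc]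
        have h2 : ∀ l, (¬ ∃ j s, l = c j s) → nc b l := by
          rintro (_|_|_) <;> simp [nc]
        simp [h2 _ h, h2 _ h']
    rw [FF_succ, FF_succ, mr_mq _ _ _ h1, ch_mq, dl_comp _ _ hg, mr_mq _ _ _ h1, ih, ih, hc]

lemma FF_D (b : ℕ) (q : ℤ) (a) (hK : a ∈ KK) (hS : Sup (kp 0 b) a) :
    FF b q (ch 1 a) = FF b (q+1) a + sg q * FF b (q+1) (mq f1 a) := by
  induction b generalizing q a with
  | zero =>
    obtain ⟨r, rfl⟩ := Sup_none hS
    simp only [map_zsmul, ch_one, mq_one, FF_zero, sca_one]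
    split_ifs with h1 h2
    · omega
    · simp
    · obtain rfl : q = -1 := by omega
      simp [sg_neg, sg_one]
    · simp
  | succ b ih =>
    have hDr : ∀ a, mr (nc b) (ch 1 a) = ch 1 (mr (nc b) a) + mr (nc b) (ch (dl (c b (altb q))) a)
        + mr (nc b) (ch (dl (c b (altb (q+1)))) a) := by
      intro a
      rw [ch_mr, ← map_add, ← map_add]
      congr 1
      simp only [ch_apply]
      have : (1 : Lb → ℤ) = pull (rst (nc b)) 1 + dl (c b (altb q)) + dl (c b (altb (q+1))) := by
        classical
        funext l
        simp only [Pi.add_apply, pull_rst, Pi.one_apply, dl, altb_succ]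
        generalize altb q = t
        rcases l with ⟨l, s⟩ | ⟨l, s⟩ | ⟨l, s⟩ <;> by_cases h : l = b <;> cases s <;> cases t <;> simp [nc, h]
      conv_lhs => rw [this]
      simp only [cd_add]
    have hs : ∀ a, Sup (kp 0 (b+1)) a → Sup (kp 0 b) (mr (nc b) a) := by
      intro a ha
      apply Sup_mr ha
      rintro (⟨l,s⟩|⟨l,s⟩|⟨l,s⟩) <;> simp [kp, nc] <;> omega
    have hk : ∀ a ∈ KK, mr (nc b) a ∈ KK := fun a ha =>
      KK_mr ha _ (by rintro (_|_|_) <;> simp [neg, nc])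
    have hE : ∀ a, mr (nc b) (mq f1 a) = mq f1 (mr (nc b) a) := fun a =>
      mr_mq _ _ _ (by rintro (_|_|_) <;> simp [nc, f1])
    have e1 := ih q (mr (nc b) a) (hk _ hK) (hs _ hS)
    have e2 := ih (q-1) (mr (nc b) (ch (dl (c b (altb q))) a)) (hk _ (KK_ch hK _)) (hs _ (Sup_cd hS _))
    have e3 : ch (dl (c b (altb (q+1)))) (ch (dl (c b (altb q))) a) = 0 := by
      have := KK_ant (c b (altb (q+1))) a hK
      rwa [neg, show (!altb (q+1)) = altb q by rw [altb_succ]; simp] at this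
    rw [FF_succ, FF_succ, FF_succ, ch_comm _ 1, hDr, map_neg, map_neg, hDr, ch_self, e3, hE,
      ch_mq, dl_comp _ _ f11, hE, f1, show (!altb (q+1)) = altb q by rw [altb_succ]; simp]
    simp only [map_add, map_zero, e1, e2, add_zero, sub_add_cancel, add_sub_cancel_right, sg_sub, sg_one]
    ring
end

set_option linter.unusedSimpArgs false
noncomputable section
open Lb

/-- numerical data -/
structure NumD (b : ℕ) (h : ℤ) (α β : ℤ → ℤ → ℤ) : Prop where
  rel : ∀ i j, i ≤ h → j ≤ h → α i j + sg (i+j) * β i j = α (i-1) j + sg i * β (i-1) j +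
    sg i * (α i (j-1) + sg j * β i (j-1)) + if i = 0 ∧ j = 0 then 1 else 0
  rel2 : ∀ i j, i ≤ h → j ≤ h → β i j + sg (i+j) * α i j = β (i-1) j + sg i * α (i-1) j +
    sg i * (β i (j-1) + sg j * α i (j-1)) + if i = 0 ∧ j = 0 then 1 else 0
  sa : ∀ i j, α j i = sg (i*j) * α i j
  sb : ∀ i j, β j i = sg (i*j) * β i j
  out : ∀ i j : ℤ, (i + j + 1 < 0 ∨ b < i + j + 1) → α i j = 0 ∧ β i j = 0
  half : ∀ i, 1 ≤ i → i ≤ h → ∃ w w' v, α i i = w + sg i * w ∧ β i i = w' + sg i * w' ∧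
    ((b : ℤ) < 2*i+1 → 0 = α (i-1) i + sg i * β (i-1) i + (v - sg i * v))

lemma num_of_fam (b : ℕ) (h : ℤ) (z) (hz : FamL 0 b h z) : ∃ α β, NumD b h α β := by
  have hT : ∀ q a, FF b q (mq tw a) = FF b q a := fun q a =>
    FF_mq tw tt (by intros; rfl) b q a
  have h12 : ∀ q a, FF b q (mq f2 a) = FF b q (mq f1 a) := by
    intro q a
    rw [← FF_mq (f1 ∘ f2) (by rintro (_|_|_) <;> simp [f1, f2]) (by intros; simp [f1, f2]) b q (mq f2 a),
      mq_mq, Function.comp_assoc, show f2 ∘ f2 = id from funext f22]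
    rfl
  have hTE : ∀ q a, FF b q (mq f1 (mq tw a)) = FF b q (mq f1 a) := by
    intro q a
    rw [mq_mq, show f1 ∘ tw = tw ∘ f2 by funext l; cases l <;> rfl, ← mq_mq, hT, h12]
  have hf1 : ∀ a, mq f1 (mq f1 a) = a := (opsL b 0).E11
  have h1f2 : ∀ q a, FF b q (mq f1 (mq f2 a)) = FF b q a := by
    intro q a
    rw [mq_mq, FF_mq (f1 ∘ f2) (by rintro (_|_|_) <;> simp [f1, f2]) (by intros; simp [f1, f2])]
  refine ⟨fun i j => FF b (i+j+1) (z i j), fun i j => FF b (i+j+1) (mq f1 (z i j)), ?_, ?_, ?_, ?_, ?_, ?_⟩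
  · intro i j hi hj
    have e := FF_D b (i+j) (z i j) (hz.mem i j).1 (hz.mem i j).2
    rw [← e, hz.rel i j hi hj]
    have e1 : i - 1 + j + 1 = i + j := by ring
    have e2 : i + (j - 1) + 1 = i + j := by ring
    simp only [e1, e2, map_add, map_zsmul, h12, smul_eq_mul]
    congr 1
    split_ifs with h0
    · rw [FF_one, if_pos (by omega)]
    · simp
  · intro i j hi hj
    have h1 := (opsL b 0).K1 _ (hz.mem i j)
    have e := FF_D b (i+j) (mq f1 (z i j)) h1.1 h1.2
    rw [hf1, ch1_mq, hz.rel i j hi hj] at e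
    rw [← e]
    have e1 : i - 1 + j + 1 = i + j := by ring
    have e2 : i + (j - 1) + 1 = i + j := by ring
    simp only [e1, e2, map_add, map_zsmul, h1f2, hf1, smul_eq_mul]
    congr 1
    split_ifs with h0
    · rw [mq_one, FF_one, if_pos (by omega)]
    · simp
  · intro i j
    beta_reduce
    rw [hz.symm i j, map_zsmul, hT, add_comm j i]; rfl
  · intro i j
    beta_reduce
    rw [hz.symm i j, map_zsmul, map_zsmul, hTE, add_comm j i]; rfl
  · intro i j hij
    exact ⟨FF_out _ _ hij _, FF_out _ _ hij _⟩
  · intro i hi hi'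
    obtain ⟨W, hW, c, h1, h2⟩ := hz.half i hi hi'
    refine ⟨FF b (i+i+1) W, FF b (i+i+1) (mq f1 W), FF b (2*i) c, ?_, ?_, ?_⟩
    · simp only [h1, map_add, map_zsmul, hT, smul_eq_mul]
    · simp only [h1, map_add, map_zsmul, hTE, smul_eq_mul]
    · intro hb
      have e := FF_D b (2*i) W hW.1 hW.2
      rw [FF_out _ (2*i+1) (Or.inr hb), FF_out _ (2*i+1) (Or.inr hb), h2] at e
      simp only [map_add, map_sub, map_zsmul, hT, smul_eq_mul] at e
      rw [show i - 1 + i + 1 = 2 * i by ring]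
      linarith

namespace NumD
variable {b : ℕ} {h : ℤ} {α β : ℤ → ℤ → ℤ}

lemma two (i : ℤ) (x : ℤ) : (2 : ℤ) ∣ sg i * x - x := by
  rcases sg_cases i with h | h <;> rw [h]
  · simp
  · exact ⟨-x, by ring⟩

lemma step (H : NumD b h α β) (i j) (hi : i ≤ h) (hj : j ≤ h) :
    (2:ℤ) ∣ (α i j + β i j) - (α (i-1) j + β (i-1) j) - (α i (j-1) + β i (j-1))
      - if i = 0 ∧ j = 0 then 1 else 0 := by
  have := H.rel i j hi hj
  generalize (if i = 0 ∧ j = 0 then (1:ℤ) else 0) = o at *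
  rw [mul_add] at this
  have a1 := two (i+j) (β i j)
  have a2 := two i (β (i-1) j)
  have a3 := two i (α i (j-1))
  have a4 := two j (β i (j-1))
  have a5 := two i (sg j * β i (j-1))
  omega

lemma neg_even (H : NumD b h α β) (n : ℕ) : ∀ i j : ℤ, i ≤ h → j ≤ h → (i < 0 ∨ j < 0) → i + j + 1 ≤ n →
    (2:ℤ) ∣ α i j + β i j := by
  induction n with
  | zero =>
    intro i j hi hj hn hs
    have := H.rel i j hi hj
    rw [(H.out (i-1) j (by push_cast at hs; omega)).1, (H.out (i-1) j (by push_cast at hs; omega)).2,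
      (H.out i (j-1) (by push_cast at hs; omega)).1, (H.out i (j-1) (by push_cast at hs; omega)).2, if_neg (by omega)] at this
    have a1 := two (i+j) (β i j)
    omega
  | succ n ih =>
    intro i j hi hj hn hs
    push_cast at hs
    have := H.step i j hi hj
    rw [if_neg (by omega)] at this
    have e1 := ih (i-1) j (by omega) hj (by omega) (by omega)
    have e2 := ih i (j-1) hi (by omega) (by omega) (by omega)
    omega

lemma par (H : NumD b h α β) (n : ℕ) : ∀ i j : ℕ, (i:ℤ) ≤ h → (j:ℤ) ≤ h → i + j = n →
    (2:ℤ) ∣ α i j + β i j - (i+j).choose i := by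
  induction n with
  | zero =>
    intro i j hi hj hn
    obtain ⟨rfl, rfl⟩ : i = 0 ∧ j = 0 := by omega
    have := H.step 0 0 hi hj
    have e1 := H.neg_even 0 (0-1) 0 (by simp at hi; omega) hj (by omega) (by simp)
    have e2 := H.neg_even 0 0 (0-1) hj (by simp at hi; omega) (by omega) (by simp)
    simp only [and_self, if_true] at this
    simp only [Nat.cast_zero, Nat.add_zero, Nat.choose_self, Nat.cast_one]
    omega
  | succ n ih =>
    intro i j hi hj hn
    have := H.step i j hi hj
    rw [if_neg (by omega)] at this
    rcases i with _ | i
    · rcases j with _ | j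
      · omega
      · have e1 := H.neg_even (j+1) (-1) (j+1) (by push_cast at *; omega) (by push_cast at *; omega) (by omega) (by push_cast; omega)
        have e2 := ih 0 j hi (by push_cast at *; omega) (by omega)
        push_cast at *
        simp at *
        omega
    · rcases j with _ | j
      · have e1 := H.neg_even (i+1) (i+1) (-1) (by push_cast at *; omega) (by push_cast at *; omega) (by omega) (by push_cast; omega)
        have e2 := ih i 0 (by push_cast at *; omega) hj (by omega)
        push_cast at *
        simp at *
        omega
      · have e1 := ih (i+1) j hi (by push_cast at *; omega) (by omega)
        have e2 := ih i (j+1) (by push_cast at *; omega) hj (by omega)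
        rw [show i + 1 + (j+1) = (i + (j+1)) + 1 by ring, Nat.choose_succ_succ]
        rw [show i + 1 + j = i + (j+1) by ring] at e1
        push_cast at *
        simp only [add_sub_cancel_right, Nat.succ_eq_add_one] at *
        omega

lemma odd_choose (r : ℕ) (k : ℕ) (hk : k < 2^r) : ¬ 2 ∣ (2^r-1).choose k := by
  induction k with
  | zero => simp
  | succ k ih =>
    have h1 : 2 ∣ (2^r).choose (k+1) := Nat.Prime.dvd_choose_pow Nat.prime_two (by omega) (by omega)
    have h2 := ih (by omega)
    have h3 : (2^r).choose (k+1) = (2^r-1).choose k + (2^r-1).choose (k+1) := by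
      conv_lhs => rw [show 2^r = (2^r-1)+1 by omega]
      rw [Nat.choose_succ_succ]
    omega

lemma oddP (H : NumD b h α β) (r i j : ℕ) (hi : (i:ℤ) ≤ h) (hj : (j:ℤ) ≤ h) (hij : i + j + 1 = 2^r) :
    ¬ (2:ℤ) ∣ α i j + β i j := by
  have := H.par _ i j hi hj rfl
  have h2 := odd_choose r i (by omega)
  rw [show 2^r-1 = i+j by omega] at h2
  omega

lemma caseA (r : ℕ) (hb : b + 1 = 2 * 2^r) (hh : h = 2^r) (H : NumD b h α β) : False := by
  have e := H.oddP (r+1) (2^r) (2^r-1) (by simp [hh]) (by rw [hh]; have : 0 < 2^r := by positivity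
                                                          push_cast [Nat.cast_sub this]; omega)
    (by rw [pow_succ]; have : 0 < 2^r := by positivity
        omega)
  have := H.out (2^r : ℕ) (2^r-1 : ℕ) (by right; have : 0 < 2^r := by positivity
                                          omega)
  rw [this.1, this.2] at e
  simp at e

lemma caseB (r : ℕ) (hb : b = 2 * 2^r) (hh : h = 2^r) (H : NumD b h α β) : False := by
  rcases r with _ | r
  · obtain ⟨w, w', v, h1, h2, h3⟩ := H.half 1 (by omega) (by omega)
    have := h3 (by simp at hb; omega)
    have e := H.oddP 1 0 1 (by simp [hh]) (by simp [hh]) (by simp)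
    rw [sg_one] at this
    simp only [sub_self] at this
    push_cast at e
    omega
  · have hp : 0 < 2^(r+1) := by positivity
    have e := H.oddP (r+1+1) (2^(r+1)-1) (2^(r+1)) (by rw [hh]; push_cast [Nat.cast_sub hp]; omega)
      (by simp [hh])
      (by rw [pow_succ _ (r+1)]; omega)
    have hr := H.rel (2^(r+1)) (2^(r+1)) hh.ge hh.ge
    have ho := H.out (2^(r+1)) (2^(r+1)) (by right; rw [hb]; push_cast; omega)
    have ev : Even ((2:ℤ)^(r+1)) := by simp [Int.even_pow]
    have s1 := H.sa (2^(r+1) - 1) (2^(r+1))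
    have s2 := H.sb (2^(r+1) - 1) (2^(r+1))
    have e0 : sg (2^(r+1)) = 1 := by simp [sg, ev]
    have e1 : sg ((2^(r+1)-1) * 2^(r+1)) = 1 := by simp [sg, ev, Int.even_mul]
    rw [ho.1, ho.2, if_neg (by have : (0:ℤ) < 2^(r+1) := by positivity
                               omega), s1, s2, e0, e1] at hr
    push_cast [Nat.cast_sub hp] at e
    omega

lemma caseC (r : ℕ) (hr1 : 1 ≤ r) (hb : b = 2 * 2^r + 1) (hh : h = 2^r + 1) (H : NumD b h α β) : False := by
  have hp : 0 < 2^r := by positivity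
  have hp' : (0:ℤ) < 2^r := by positivity
  have e := H.oddP (r+1) (2^r-1) (2^r) (by rw [hh]; push_cast [Nat.cast_sub hp]; omega)
      (by simp [hh]) (by rw [pow_succ _ r]; omega)
  push_cast [Nat.cast_sub hp] at e
  have ev : Even ((2:ℤ)^r) := by simp [Int.even_pow]; omega
  have e0 : sg (2^r) = 1 := by simp [sg, ev]
  have e1 : sg ((2^r-1) * 2^r) = 1 := by simp [sg, ev, Int.even_mul]
  have s1 := H.sa (2^r - 1) (2^r)
  have s2 := H.sb (2^r - 1) (2^r)
  have ho := H.out (2^r+1) (2^r) (by right; rw [hb]; push_cast; omega)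
  have r1 := H.rel (2^r+1) (2^r) (by omega) (by omega)
  have r2 := H.rel2 (2^r+1) (2^r) (by omega) (by omega)
  have r3 := H.rel (2^r) (2^r) (by omega) (by omega)
  obtain ⟨w, w', v, w1, w2, -⟩ := H.half (2^r) (by omega) (by omega)
  rw [if_neg (by omega), ho.1, ho.2] at r1 r2
  rw [if_neg (by omega), s1, s2] at r3
  simp only [sg_add, sg_one, e0, e1, add_sub_cancel_right] at *
  omega
end NumD
end

set_option linter.unusedSimpArgs false
set_option linter.unusedVariables false
noncomputable section
open Lb (f1 f2 tw kp f11 f22 tt nn)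

section EZ
variable {P : Type*} (lab : P → P → Lb)

/-- staircase product -/
def EZ : List P → List P → LL
  | [], ys => if ys.length = 1 then 1 else 0
  | _::_, [] => 0
  | x::xs, y::ys => gen (lab x y) * (EZ xs (y::ys) + sg xs.length • EZ (x::xs) ys)
termination_by xs ys => xs.length + ys.length

lemma EZ_nil (ys) : EZ lab [] ys = if ys.length = 1 then 1 else 0 := by rw [EZ]
lemma EZ_cons_nil (x xs) : EZ lab (x::xs) [] = 0 := by rw [EZ]
lemma EZ_to_nil (xs) : EZ lab xs [] = 0 := by
  cases xs
  · simp [EZ_nil]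
  · exact EZ_cons_nil _ _ _
lemma EZ_cons_cons (x xs y ys) : EZ lab (x::xs) (y::ys) =
    gen (lab x y) * (EZ lab xs (y::ys) + sg xs.length • EZ lab (x::xs) ys) := by rw [EZ]

lemma list2_ind {Q : List P → List P → Prop} (case1 : ∀ ys, Q [] ys) (case2 : ∀ x xs, Q (x::xs) [])
    (case3 : ∀ x xs y ys, Q xs (y::ys) → Q (x::xs) ys → Q (x::xs) (y::ys)) (xs ys) : Q xs ys := by
  induction xs generalizing ys with
  | nil => exact case1 ys
  | cons x xs ih =>
    induction ys with
    | nil => exact case2 x xs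
    | cons y ys ih' => exact case3 x xs y ys (ih _) ih'

/-- chains -/
abbrev Ch (P : Type*) := FreeAbelianGroup (List P)
abbrev fo (l : List P) : Ch P := FreeAbelianGroup.of l

/-- cone -/
def cns (x : P) : Ch P →+ Ch P := FreeAbelianGroup.map (fun l => x :: l)
@[simp] lemma cns_fo (x : P) (l) : cns x (fo l) = fo (x::l) := FreeAbelianGroup.map_of_apply _

/-- boundary on lists -/
def bdl : List P → Ch P
  | [] => 0
  | x::xs => fo xs - cns x (bdl xs)
/-- boundary -/
def bd : Ch P →+ Ch P := FreeAbelianGroup.lift bdl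
@[simp] lemma bd_fo (l : List P) : bd (fo l) = bdl l := FreeAbelianGroup.lift_apply_of _ _
lemma bd_cns (x : P) (e : Ch P) : bd (cns x e) = e - cns x (bd e) := by
  have : (bd.comp (cns x) : Ch P →+ Ch P) = AddMonoidHom.id _ - (cns x).comp bd := by
    ext l; simp [bdl]
  exact DFunLike.congr_fun this e

/-- bilinear extension -/
def EZ2 : Ch P →+ Ch P →+ LL := FreeAbelianGroup.lift (fun xs => FreeAbelianGroup.lift (EZ lab xs))
@[simp] lemma EZ2_fo (xs ys : List P) : EZ2 lab (fo xs) (fo ys) = EZ lab xs ys := by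
  simp [EZ2, fo]

/-- chains of lists of given length with a property -/
def Hm (Sm : List P → Prop) (n : ℕ) : AddSubgroup (Ch P) :=
  AddSubgroup.closure {e | ∃ l : List P, l.length = n ∧ Sm l ∧ e = fo l}

lemma Hm_fo {Sm : List P → Prop} {l : List P} (h : Sm l) : fo l ∈ Hm Sm l.length :=
  AddSubgroup.subset_closure ⟨l, rfl, h, rfl⟩
lemma Hm_fo' {Sm : List P → Prop} {l : List P} {n} (h : Sm l) (hn : l.length = n) : fo l ∈ Hm Sm n :=
  AddSubgroup.subset_closure ⟨l, hn, h, rfl⟩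

lemma Hm_ext {Sm : List P → Prop} {n : ℕ} {A : Type*} [AddGroup A] (f g : Ch P →+ A)
    (h : ∀ l : List P, l.length = n → Sm l → f (fo l) = g (fo l)) {e} (he : e ∈ Hm Sm n) : f e = g e := by
  have : Set.EqOn f g {e | ∃ l : List P, l.length = n ∧ Sm l ∧ e = fo l} := by
    rintro e ⟨l, h1, h2, rfl⟩; exact h l h1 h2
  exact AddMonoidHom.eqOn_closure this he

lemma Hm_map {Sm : List P → Prop} {n : ℕ} {A : Type*} [AddGroup A] (f : Ch P →+ A) (B : AddSubgroup A)
    (h : ∀ l : List P, l.length = n → Sm l → f (fo l) ∈ B) {e} (he : e ∈ Hm Sm n) : f e ∈ B := by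
  have : Hm Sm n ≤ B.comap f := by
    unfold Hm
    rw [AddSubgroup.closure_le]
    rintro e ⟨l, h1, h2, rfl⟩; exact h l h1 h2
  exact this he

lemma bdl_mem (l : List P) (n : ℕ) (h : l.length = n + 1) {Sm : List P → Prop} (hS : ∀ l', l'.Sublist l → Sm l') :
    bdl l ∈ Hm Sm n := by
  induction l generalizing n Sm with
  | nil => simp at h
  | cons x xs ih =>
    simp only [List.length_cons, add_left_inj] at h
    rw [bdl]
    refine sub_mem (Hm_fo' (hS _ (List.sublist_cons_self x xs)) h) ?_
    rcases n with _ | n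
    · rw [List.length_eq_zero_iff] at h
      subst h; simp [bdl]
    · have := ih n h (Sm := fun l' => l'.Sublist xs) (fun _ h => h)
      refine Hm_map (cns x) _ ?_ this
      intro l hl hl'
      rw [cns_fo]
      exact Hm_fo' (hS _ (hl'.cons_cons x)) (by simp [hl])

lemma bd_mem {Sm : List P → Prop} (hS : ∀ l l', Sm l → l'.Sublist l → Sm l') {n e} (he : e ∈ Hm Sm (n+1)) :
    bd e ∈ Hm Sm n :=
  Hm_map bd _ (fun l hl hl' => by rw [bd_fo]; exact bdl_mem l n hl (fun l' h => hS l l' hl' h)) he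

lemma Hm_mono {Sm Sm' : List P → Prop} (h : ∀ l, Sm l → Sm' l) {n e} (he : e ∈ Hm Sm n) : e ∈ Hm Sm' n :=
  Hm_map (AddMonoidHom.id _) _ (fun l hl hl' => Hm_fo' (h l hl') hl) he

lemma EZ2_cns_right (x : P) (xs : List P) (y : P) (e : Ch P) : EZ2 lab (fo (x::xs)) (cns y e) =
    gen (lab x y) * (EZ2 lab (fo xs) (cns y e) + sg xs.length • EZ2 lab (fo (x::xs)) e) := by
  induction e using FreeAbelianGroup.induction_on with
  | zero => simp
  | of l => rw [cns_fo, EZ2_fo, EZ2_fo, EZ2_fo, EZ_cons_cons]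
  | neg l h => simp only [map_neg, h, smul_neg, mul_add, mul_neg]; abel
  | add a b ha hb => simp only [map_add, ha, hb, smul_add, mul_add]; abel

lemma EZ2_cns_left (x : P) (y : P) (ys : List P) {Sm : List P → Prop} (n : ℕ) {e : Ch P} (he : e ∈ Hm Sm n) :
    EZ2 lab (cns x e) (fo (y::ys)) =
    gen (lab x y) * (EZ2 lab e (fo (y::ys)) + sg n • EZ2 lab (cns x e) (fo ys)) := by
  have := Hm_ext (((EZ2 lab).flip (fo (y::ys))).comp (cns x))
    ((AddMonoidHom.mulLeft (gen (lab x y))).comp ((EZ2 lab).flip (fo (y::ys)) + sg n • (((EZ2 lab).flip (fo ys)).comp (cns x))))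
    (fun l hl _ => by simp [EZ_cons_cons, hl]) he
  simpa using this

lemma ch_gen_mul (l a) : ch 1 (gen l * a) = a - gen l * ch 1 a := by
  have := cd_gen_mul 1 l a
  simpa [ch_apply] using this

lemma sg_mul_sg (i : ℤ) : sg i * sg i = 1 := by
  rcases sg_cases i with h | h <;> simp [h]

lemma EZ2_nil_cns (y : P) (ys : List P) : EZ2 lab (fo []) (cns y (bdl ys)) = EZ lab [] ys := by
  rcases ys with _ | ⟨z, ys⟩
  · simp [bdl, EZ_nil]
  · have h := bdl_mem (z::ys) ys.length rfl (Sm := fun _ => True) (fun _ _ => trivial)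
    have := Hm_ext ((EZ2 lab (fo [])).comp (cns y)) (FreeAbelianGroup.lift (fun _ => if ys.length = 0 then (1:LL) else 0))
      (fun l hl _ => by simp [EZ_nil, hl, ← List.length_eq_zero_iff]) h
    have e : EZ2 lab (fo []) (cns y (bdl (z::ys))) = FreeAbelianGroup.lift (fun _ => if ys.length = 0 then (1:LL) else 0) (bdl (z::ys)) := this
    rw [e, EZ_nil]
    rcases ys with _ | ⟨w, ys⟩
    · simp [bdl]
    · simp
      have : (FreeAbelianGroup.lift (fun _ => (0:LL)) : Ch P →+ LL) = 0 := by ext; simp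
      rw [this]; rfl

lemma EZ_D (xs ys : List P) (h : xs ≠ []) : ch 1 (EZ lab xs ys) = EZ2 lab (bdl xs) (fo ys) +
    sg (xs.length - 1) • EZ2 lab (fo xs) (bdl ys) := by
  match xs, ys with
  | [], ys => exact absurd rfl h
  | x::xs, [] =>
    rw [EZ_cons_nil]
    have : (EZ2 lab).flip (fo ([] : List P)) = 0 := by ext l; simp [EZ_to_nil]
    have := DFunLike.congr_fun this (bdl (x::xs))
    simp only [AddMonoidHom.flip_apply, AddMonoidHom.zero_apply] at this
    rw [this]; simp [bdl]
  | [x], y::ys =>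
    rw [EZ_cons_cons, ch_gen_mul, map_add, map_zsmul, EZ_D [x] ys (by simp)]
    simp only [bdl, map_zero, sub_zero, EZ2_fo, map_sub, EZ2_cns_right, EZ2_nil_cns, List.length_nil, List.length_cons]
    have : ch 1 (EZ lab [] (y::ys)) = 0 := by
      rw [EZ_nil]; split_ifs <;> simp [ch_one]
    rw [this]
    simp [sg_zero]
    abel
  | x::x'::xs, y::ys =>
    rw [EZ_cons_cons, ch_gen_mul, map_add, map_zsmul, EZ_D (x::x'::xs) ys (by simp), EZ_D (x'::xs) (y::ys) (by simp)]
    have hm := bdl_mem (x'::xs) xs.length rfl (Sm := fun _ => True) (fun _ _ => trivial)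
    rw [bdl.eq_2 x, bdl.eq_2 y, map_sub, map_sub, map_sub, AddMonoidHom.sub_apply, AddMonoidHom.sub_apply,
      EZ2_cns_left lab x y ys _ hm, EZ2_cns_right lab x (x'::xs) y]
    simp only [EZ2_fo, List.length_cons, Nat.cast_add, Nat.cast_one, add_sub_cancel_right, sg_add, sg_one]
    rcases sg_cases xs.length with h | h <;> rw [h] <;>
    simp only [mul_one, mul_neg, neg_mul, neg_neg, neg_smul, one_smul, smul_add, smul_neg, smul_sub, mul_add, mul_sub] <;> abel
termination_by xs.length + ys.length

lemma EZ2_D {Sm : List P → Prop} {n : ℕ} {e} (he : e ∈ Hm Sm (n+1)) (e') : ch 1 (EZ2 lab e e') =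
    EZ2 lab (bd e) e' + sg n • EZ2 lab e (bd e') := by
  induction e' using FreeAbelianGroup.induction_on with
  | zero => simp
  | of l =>
    have := Hm_ext ((ch 1).comp ((EZ2 lab).flip (fo l))) (((EZ2 lab).flip (fo l)).comp bd + sg n • (EZ2 lab).flip (bdl l))
      (fun l' hl' _ => by
        simp [EZ_D lab l' l (by rintro rfl; simp at hl'), hl']) he
    simpa using this
  | neg l h => simp only [map_neg, h, smul_neg]; abel
  | add a b ha hb => simp only [map_add, ha, hb, smul_add]; abel

lemma mq_mul (g a b) : mq g (a * b) = mq g a * mq g b := map_mul (mp _) _ _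
lemma mq_gen (g l) : mq g (gen l) = gen (g l) := by rw [mq_apply, mp_gen]; rfl

lemma EZ_T (hT : ∀ x y, lab y x = tw (lab x y)) (xs ys : List P) (h : xs ≠ []) (h' : ys ≠ []) : mq tw (EZ lab xs ys) =
    sg ((xs.length - 1) * (ys.length - 1)) • EZ lab ys xs := by
  match xs, ys with
  | [], ys => exact absurd rfl h
  | x::xs, [] => exact absurd rfl h'
  | [x], [y] => simp [EZ_cons_cons, EZ_nil, EZ_cons_nil, mq_mul, mq_gen, hT x y, sg_zero, mq_one]
  | [x], y::y'::ys =>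
    rw [EZ_cons_cons lab x, EZ_cons_cons lab y, mq_mul, mq_gen, map_add, map_zsmul, EZ_T hT [x] (y'::ys) (by simp) (by simp), hT x y]
    simp [EZ_nil, EZ_cons_nil, sg_zero]
  | x::x'::xs, [y] =>
    rw [EZ_cons_cons lab x, EZ_cons_cons lab y, mq_mul, mq_gen, map_add, map_zsmul, EZ_T hT (x'::xs) [y] (by simp) (by simp), hT x y]
    simp [EZ_nil, EZ_cons_nil, sg_zero]
  | x::x'::xs, y::y'::ys =>
    rw [EZ_cons_cons lab x, EZ_cons_cons lab y, mq_mul, mq_gen, map_add, map_zsmul, EZ_T hT (x'::xs) (y::y'::ys) (by simp) (by simp),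
      EZ_T hT (x::x'::xs) (y'::ys) (by simp) (by simp), hT x y]
    simp only [List.length_cons, Nat.cast_add, Nat.cast_one, add_sub_cancel_right]
    have e1 : sg (xs.length * (ys.length + 1)) = sg (xs.length * ys.length) * sg xs.length := by rw [mul_add, sg_add, mul_one]
    have e2 : sg ((xs.length + 1) * ys.length) = sg (xs.length * ys.length) * sg ys.length := by rw [add_mul, sg_add, one_mul]
    have e3 : sg ((xs.length + 1) * (ys.length + 1)) = - (sg (xs.length * ys.length) * sg xs.length * sg ys.length) := by
      rw [show ((xs.length:ℤ) + 1) * (ys.length + 1) = xs.length * ys.length + xs.length + ys.length + 1 by ring, sg_add, sg_add, sg_add, sg_one]; ring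
    rw [e1, e2, e3]
    simp only [sg_add, sg_one]
    rcases sg_cases xs.length with h | h <;> rcases sg_cases ys.length with h' | h' <;>
    rcases sg_cases (xs.length * ys.length) with h'' | h'' <;> rw [h, h', h''] <;>
    simp only [mul_one, mul_neg, neg_mul, neg_neg, neg_smul, one_smul, smul_add, smul_neg, smul_sub, mul_add, mul_sub] <;> abel
termination_by xs.length + ys.length

lemma EZ2_T (hT : ∀ x y, lab y x = tw (lab x y)) {Sm Sm' : List P → Prop} {n m : ℕ} {e e'} (he : e ∈ Hm Sm (n+1)) (he' : e' ∈ Hm Sm' (m+1)) :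
    mq tw (EZ2 lab e e') = sg (n * m) • EZ2 lab e' e := by
  have := Hm_ext (((AddMonoidHom.compHom (mq tw)).comp (EZ2 lab)).flip e') (sg (n*m) • (EZ2 lab e'))
    (fun l hl _ => by
      have := Hm_ext ((mq tw).comp (EZ2 lab (fo l))) (sg (n*m) • (EZ2 lab).flip (fo l)) (fun l' hl' _ => by
        simp [EZ_T lab hT l l' (by rintro rfl; simp at hl) (by rintro rfl; simp at hl'), hl, hl']) he'
      simpa using this) he
  simpa using this

lemma EZ_E1 (ng : P → P) (h1 : ∀ x y, lab (ng x) y = f1 (lab x y)) (xs ys) :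
    mq f1 (EZ lab xs ys) = EZ lab (xs.map ng) ys := by
  induction xs, ys using list2_ind with
  | case1 ys => simp [EZ_nil]; split_ifs <;> simp [mq_one]
  | case2 x xs => simp [EZ_cons_nil]
  | case3 x xs y ys ih1 ih2 =>
    rw [EZ_cons_cons, mq_mul, mq_gen, map_add, map_zsmul, ih1, ih2, List.map_cons, EZ_cons_cons, h1]
    simp

lemma EZ_E2 (ng : P → P) (h1 : ∀ x y, lab x (ng y) = f2 (lab x y)) (xs ys) :
    mq f2 (EZ lab xs ys) = EZ lab xs (ys.map ng) := by
  induction xs, ys using list2_ind with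
  | case1 ys => simp [EZ_nil]; split_ifs <;> simp [mq_one]
  | case2 x xs => simp [EZ_cons_nil]
  | case3 x xs y ys ih1 ih2 =>
    rw [EZ_cons_cons, mq_mul, mq_gen, map_add, map_zsmul, ih1, ih2, List.map_cons, EZ_cons_cons, h1]

/-- push forward -/
def psh {Q : Type*} (g : P → Q) : Ch P →+ Ch Q := FreeAbelianGroup.map (List.map g)
@[simp] lemma psh_fo {Q : Type*} (g : P → Q) (l) : psh g (fo l) = fo (l.map g) := FreeAbelianGroup.map_of_apply _

lemma EZ2_E1 (ng : P → P) (h1 : ∀ x y, lab (ng x) y = f1 (lab x y)) (e e') :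
    EZ2 lab (psh ng e) e' = mq f1 (EZ2 lab e e') := by
  have : (EZ2 lab).comp (psh ng) = (AddMonoidHom.compHom (mq f1)).comp (EZ2 lab) := by
    ext xs ys; simp [EZ_E1 lab ng h1]
  exact DFunLike.congr_fun (DFunLike.congr_fun this e) e'

lemma EZ2_E2 (ng : P → P) (h1 : ∀ x y, lab x (ng y) = f2 (lab x y)) (e e') :
    EZ2 lab e (psh ng e') = mq f2 (EZ2 lab e e') := by
  have : (EZ2 lab).flip.comp (psh ng) = (AddMonoidHom.compHom (mq f2)).comp (EZ2 lab).flip := by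
    ext xs ys; simp [EZ_E2 lab ng h1]
  exact DFunLike.congr_fun (DFunLike.congr_fun this e') e

lemma EZ_Sup (A : Lb → Prop) (xs ys : List P) (h : ∀ x ∈ xs, ∀ y ∈ ys, A (lab x y)) : Sup A (EZ lab xs ys) := by
  induction xs, ys using list2_ind with
  | case1 ys => rw [EZ_nil]; split_ifs
                · exact Sup_one _
                · exact Sup_zero _
  | case2 x xs => rw [EZ_cons_nil]; exact Sup_zero _
  | case3 x xs y ys ih1 ih2 =>
    rw [EZ_cons_cons]
    refine Sup_mul (Sup_gen (h _ (by simp) _ (by simp))) (Sup_add (ih1 ?_) (Sup_smul _ (ih2 ?_)))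
    · intro u hu v hv; exact h u (by simp [hu]) v hv
    · intro u hu v hv; exact h u hu v (by simp [hv])

end EZ
end

set_option linter.unusedSimpArgs false
set_option linter.unusedVariables false
noncomputable section
open Lb (f1 f2 tw kp f11 f22 tt nn)

/-- labelling data -/
structure LabD {P : Type*} (ng : P → P) (lab : P → P → Lb) (Sm : List P → Prop) (a b : ℕ) : Prop where
  h1 : ∀ x y, lab (ng x) y = f1 (lab x y)
  h2 : ∀ x y, lab x (ng y) = f2 (lab x y)
  hT : ∀ x y, lab y x = tw (lab x y)
  sub : ∀ l l', Sm l → l'.Sublist l → Sm l'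
  ant : ∀ xs ys, Sm xs → Sm ys → ∀ x ∈ xs, ∀ y ∈ ys, ∀ x' ∈ xs, ∀ y' ∈ ys, lab x' y' ≠ (lab x y).neg
  dg : ∀ xs, Sm xs → ∀ x ∈ xs, lab x x = Lb.c 0 true
  bdd : ∀ xs ys, Sm xs → Sm ys → ∀ x ∈ xs, ∀ y ∈ ys, kp a b (lab x y)

namespace LabD
variable {P : Type*} {ng : P → P} {lab : P → P → Lb} {Sm : List P → Prop} {a b : ℕ}

/-- labels occurring -/
def occ (lab : P → P → Lb) (xs ys : List P) (l : Lb) : Prop := ∃ x ∈ xs, ∃ y ∈ ys, l = lab x y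

lemma occ_KS (H : LabD ng lab Sm a b) {xs ys} (hx : Sm xs) (hy : Sm ys) {c} (h : Sup (occ lab xs ys) c) : c ∈ KS a b := by
  constructor
  · refine Sup_KK ?_ h
    rintro l ⟨x, hx', y, hy', rfl⟩ ⟨x', hx'', y', hy'', h⟩
    exact H.ant xs ys hx hy x hx' y hy' x' hx'' y' hy'' h.symm
  · have : Sup (kp a b) (mp some c) := Sup_mp h some (by
      rintro l l' ⟨x, hx', y, hy', rfl⟩ hh
      cases hh
      exact H.bdd xs ys hx hy x hx' y hy')
    rwa [mp_some] at this

lemma EZ2_KS (H : LabD ng lab Sm a b) {n m : ℕ} {e e'} (he : e ∈ Hm Sm n) (he' : e' ∈ Hm Sm m) : EZ2 lab e e' ∈ KS a b := by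
  refine Hm_map ((EZ2 lab).flip e') _ ?_ he
  intro l hl hS
  refine Hm_map (EZ2 lab (fo l)) _ ?_ he'
  intro l' hl' hS'
  rw [EZ2_fo]
  exact H.occ_KS hS hS' (EZ_Sup lab _ _ _ (fun x hx y hy => ⟨x, hx, y, hy, rfl⟩))

lemma half_fo (H : LabD ng lab Sm a b) (n : ℕ) (s : List P) (hs : s.length = n + 2) (hS : Sm s) :
    ∃ W ∈ KS a b, ∃ c, EZ lab s s = W + sg (n+1) • mq tw W ∧
      ch 1 W = EZ2 lab (bdl s) (fo s) + (c - sg (n+1) • mq tw c) := by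
  have key : ∀ x xs, xs ≠ [] → Sm (x::xs) → gen (lab x x) * EZ lab xs (x::xs) ∈ KS a b ∧
      EZ lab (x::xs) (x::xs) = gen (lab x x) * EZ lab xs (x::xs) +
        sg xs.length • mq tw (gen (lab x x) * EZ lab xs (x::xs)) := by
    intro x xs hne hS
    constructor
    · refine H.occ_KS hS hS (Sup_mul (Sup_gen ⟨x, by simp, x, by simp, rfl⟩)
        (EZ_Sup lab _ _ _ (fun x' hx y hy => ⟨x', by simp [hx], y, hy, rfl⟩)))
    · rw [mq_mul, mq_gen, ← H.hT, EZ_T lab H.hT xs (x::xs) hne (by simp), EZ_cons_cons]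
      have : sg ((xs.length - 1) * ((x::xs).length - 1)) = 1 := by
        simp only [List.length_cons, Nat.cast_add, Nat.cast_one, add_sub_cancel_right]
        rw [sub_mul, sg_sub, sg_mul_self, one_mul, sg_mul_sg]
      rw [this, one_smul, mul_add, mul_smul_comm]
  rcases s with _ | ⟨x, xs⟩
  · simp at hs
  simp only [List.length_cons, Nat.add_right_cancel_iff] at hs
  have hne : xs ≠ [] := by rintro rfl; simp at hs
  obtain ⟨k1, k2⟩ := key x xs hne hS
  have hl : sg (n+1) = sg xs.length := by rw [hs]; push_cast; rfl
  refine ⟨_, k1, ?_⟩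
  rw [hl]
  have hSx : Sm xs := H.sub _ _ hS (List.sublist_cons_self x xs)
  have hb : bdl xs ∈ Hm Sm n := bdl_mem xs n hs (fun l' h => H.sub _ _ hSx h)
  have hcb : cns x (bdl xs) ∈ Hm (fun _ => True) (n+1) :=
    Hm_map (cns x) _ (fun l hl _ => by rw [cns_fo]; exact Hm_fo' trivial (by simp [hl])) hb
  have hxs : fo xs ∈ Hm (fun _ => True) (n+1) := Hm_fo' trivial hs
  have hgx : mq tw (gen (lab x x)) = gen (lab x x) := by rw [mq_gen, ← H.hT]
  have hTc := EZ2_T lab H.hT hcb hxs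
  obtain ⟨c1, hc1⟩ : ∃ c1, sg xs.length • (gen (lab x x) * EZ lab xs xs) = c1 - sg xs.length • mq tw c1 := by
    rcases xs with _ | ⟨x', xs⟩
    · exact absurd rfl hne
    rcases xs with _ | ⟨x'', xs⟩
    · refine ⟨0, ?_⟩
      simp only [EZ_cons_cons, EZ_nil, EZ_cons_nil]
      rw [H.dg _ hS x (by simp), H.dg _ hS x' (by simp)]
      simp [gen]
    · obtain ⟨k3, k4⟩ := key x' (x''::xs) (by simp) hSx
      generalize gen (lab x' x') * EZ lab (x''::xs) (x'::x''::xs) = W at k4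
      refine ⟨sg (x'::x''::xs).length • (gen (lab x x) * W), ?_⟩
      rw [k4, map_zsmul, mq_mul, hgx]
      simp only [List.length_cons, Nat.cast_add, Nat.cast_one, sg_add, sg_one]
      rcases sg_cases xs.length with h | h <;> rw [h] <;>
      simp only [mul_one, mul_neg, neg_mul, neg_neg, neg_smul, one_smul, smul_add, smul_neg, smul_sub, mul_add, mul_sub] <;> abel
  refine ⟨c1 - sg xs.length • (gen (lab x x) * EZ2 lab (cns x (bdl xs)) (fo xs)), k2, ?_⟩
  rw [ch_gen_mul, EZ_D lab xs _ hne]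
  rw [bdl.eq_2 x, map_sub, map_sub, AddMonoidHom.sub_apply, EZ2_cns_left lab x x xs _ hb, map_sub, map_zsmul, mq_mul, hgx, hTc]
  have hnn : sg ((n:ℤ) * n) = - sg xs.length := by
    rw [sg_mul_self, ← hl, sg_add, sg_one]; ring
  have hn' : sg (n:ℤ) = - sg xs.length := by
    rw [← hl, sg_add, sg_one]; ring
  have hn2 : sg ((xs.length:ℤ)-1) = - sg xs.length := by
    rw [sg_sub, sg_one]; ring
  rw [hnn, hn', hn2]
  simp only [EZ2_fo] 
  rcases sg_cases xs.length with h | h <;> rw [h] at hc1 ⊢ <;>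
  simp only [mul_one, mul_neg, neg_mul, neg_neg, neg_smul, one_smul, smul_add, smul_neg, smul_sub, mul_add, mul_sub] at hc1 ⊢
  · rw [show c1 - _ - (_ - _) = (c1 - mq tw c1) - gen (lab x x) * EZ2 lab (cns x (bdl xs)) (fo xs) - gen (lab x x) * EZ2 lab (fo xs) (cns x (bdl xs)) by abel, ← hc1]
    abel
  · rw [show gen (lab x x) * EZ lab xs xs = - (c1 + mq tw c1) by rw [show c1 + mq tw c1 = c1 - - mq tw c1 by abel, ← hc1]; abel]
    abel

lemma half (H : LabD ng lab Sm a b) (n : ℕ) {e} (he : e ∈ Hm Sm (n+2)) :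
    ∃ W ∈ KS a b, ∃ c, EZ2 lab e e = W + sg (n+1) • mq tw W ∧
      ch 1 W = EZ2 lab (bd e) e + (c - sg (n+1) • mq tw c) := by
  induction he using AddSubgroup.closure_induction with
  | mem e he =>
    obtain ⟨l, hl, hS, rfl⟩ := he
    simpa using H.half_fo n l hl hS
  | zero => exact ⟨0, zero_mem _, 0, by simp, by simp⟩
  | neg e he ih =>
    obtain ⟨W, hW, c, h1, h2⟩ := ih
    exact ⟨W, hW, c, by simpa using h1, by simpa using h2⟩
  | add e e' he he' ih ih' =>
    obtain ⟨W, hW, c, h1, h2⟩ := ih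
    obtain ⟨W', hW', c', h1', h2'⟩ := ih'
    have he : e ∈ Hm Sm (n+2) := he
    have he' : e' ∈ Hm Sm (n+2) := he'
    have t1 := EZ2_T lab H.hT he he'
    have t2 := EZ2_T lab H.hT (bd_mem H.sub he') he
    have t3 := EZ2_D lab he e'
    push_cast at t1 t2 t3
    rw [sg_mul_self] at t1
    rw [mul_add, sg_add, sg_mul_self, mul_one, sg_mul_sg, one_smul] at t2
    refine ⟨W + W' + EZ2 lab e e', add_mem (add_mem hW hW') (H.EZ2_KS he he'), c + c' - EZ2 lab (bd e') e, ?_, ?_⟩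
    · simp only [map_add, AddMonoidHom.add_apply, h1, h1', t1]
      rcases sg_cases ((n:ℤ)+1) with h | h <;> rw [h] <;> simp <;> abel
    · simp only [map_add, map_sub, AddMonoidHom.add_apply, h2, h2', t2, t3]
      rcases sg_cases ((n:ℤ)+1) with h | h <;> rw [h] <;> simp <;> abel

open Classical in
/-- the family -/
lemma fam (H : LabD ng lab Sm a b) (N : ℕ) (e : ℕ → Ch P) (he : ∀ i ≤ N, e i ∈ Hm Sm (i+1))
    (h0 : bd (e 0) = fo []) (hb : ∀ i, i + 1 ≤ N → bd (e (i+1)) = e i + sg (i+1) • psh ng (e i))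
    (h00 : EZ2 lab (fo []) (e 0) = 1) :
    ∃ z, FamL a b N z := by
  have hn1 : ∀ j, 1 ≤ j → j ≤ N → EZ2 lab (fo []) (e j) = 0 := by
    intro j h1 h2
    refine Hm_ext (EZ2 lab (fo [])) 0 ?_ (he j h2)
    intro l hl _
    rw [EZ2_fo, EZ_nil, hl]
    simp; omega
  have hn2 : ∀ c, EZ2 lab c (fo []) = 0 := by
    intro c
    have : (EZ2 lab).flip (fo ([] : List P)) = 0 := by ext l; simp [EZ_to_nil]
    exact DFunLike.congr_fun this c
  let z : ℤ → ℤ → LL := fun i j => if 0 ≤ i ∧ i ≤ N ∧ 0 ≤ j ∧ j ≤ N then EZ2 lab (e i.toNat) (e j.toNat) else 0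
  have hz : ∀ i j : ℕ, i ≤ N → j ≤ N → z i j = EZ2 lab (e i) (e j) := by
    intro i j hi hj
    simp only [z]
    rw [if_pos (by omega)]; simp
  have hz0 : ∀ i j : ℤ, ¬ (0 ≤ i ∧ i ≤ N ∧ 0 ≤ j ∧ j ≤ N) → z i j = 0 := by
    intro i j h
    simp only [z]
    rw [if_neg h]
  have L1 : ∀ i j : ℕ, i ≤ N → j ≤ N → EZ2 lab (bd (e i)) (e j) = z (i-1) j + sg i • mq f1 (z (i-1) j) + 
      if (i:ℤ) = 0 ∧ (j:ℤ) = 0 then 1 else 0 := by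
    intro i j hi hj
    rcases i with _ | i
    · rw [h0, hz0 _ _ (by simp)]
      rcases j with _ | j
      · simp [h00]
      · rw [hn1 _ (by omega) hj]
        have : ¬ ((j:ℤ) + 1 = 0) := by omega
        simp [this]
    · rw [hb _ hi, if_neg (by push_cast; omega), map_add, map_zsmul, AddMonoidHom.add_apply, AddMonoidHom.smul_apply, EZ2_E1 lab ng H.h1]
      push_cast
      rw [add_sub_cancel_right, hz i j (by omega) hj, add_zero]
  have L2 : ∀ i j : ℕ, i ≤ N → j ≤ N → EZ2 lab (e i) (bd (e j)) = z i (j-1) + sg j • mq f2 (z i (j-1)) := by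
    intro i j hi hj
    rcases j with _ | j
    · rw [h0, hz0 _ _ (by simp), hn2]; simp
    · rw [hb _ hj, map_add, map_zsmul, EZ2_E2 lab ng H.h2]
      push_cast
      rw [add_sub_cancel_right, hz i j (by omega) (by omega)]
  refine ⟨z, ?_, ?_, ?_, ?_⟩
  · intro i j hi hj
    by_cases h : 0 ≤ i ∧ 0 ≤ j
    · lift i to ℕ using h.1
      lift j to ℕ using h.2
      rw [hz i j (by omega) (by omega), EZ2_D lab (he i (by omega)), L1 i j (by omega) (by omega), L2 i j (by omega) (by omega)]
      abel
    · rw [hz0 i j (by omega), hz0 (i-1) j (by omega), hz0 i (j-1) (by omega), if_neg (by omega)]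
      simp
  · intro i j
    by_cases h : 0 ≤ i ∧ i ≤ N ∧ 0 ≤ j ∧ j ≤ N
    · obtain ⟨h1, h2, h3, h4⟩ := h
      lift i to ℕ using h1
      lift j to ℕ using h3
      rw [hz i j (by omega) (by omega), hz j i (by omega) (by omega), EZ2_T lab H.hT (he i (by omega)) (he j (by omega)), smul_smul, sg_mul_sg, one_smul]
    · rw [hz0 i j h, hz0 j i (by tauto)]; simp
  · intro i j
    by_cases h : 0 ≤ i ∧ i ≤ N ∧ 0 ≤ j ∧ j ≤ N
    · obtain ⟨h1, h2, h3, h4⟩ := h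
      lift i to ℕ using h1
      lift j to ℕ using h3
      rw [hz i j (by omega) (by omega)]
      exact H.EZ2_KS (he i (by omega)) (he j (by omega))
    · rw [hz0 i j h]; exact zero_mem _
  · intro i h1 h2
    lift i to ℕ using by omega
    obtain ⟨i, rfl⟩ : ∃ k, i = k + 1 := ⟨i - 1, by omega⟩
    obtain ⟨W, hW, c, e1, e2⟩ := H.half i (he (i+1) (by omega))
    refine ⟨W, hW, c, ?_, ?_⟩
    · rw [hz _ _ (by omega) (by omega), e1]; push_cast; rfl
    · rw [e2, L1 _ _ (by omega) (by omega), if_neg (by push_cast; omega), add_zero]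
      push_cast; rfl
end LabD
end

set_option linter.unusedSimpArgs false
set_option linter.unusedVariables false
noncomputable section

section Prism
variable {P : Type*} {Q : Type*}

/-- prism on lists -/
def prl (f g : P → Q) : List P → Ch Q
  | [] => 0
  | x::xs => fo (f x :: g x :: xs.map g) - cns (f x) (prl f g xs)
/-- prism -/
def pr (f g : P → Q) : Ch P →+ Ch Q := FreeAbelianGroup.lift (prl f g)
@[simp] lemma pr_fo (f g : P → Q) (l : List P) : pr f g (fo l) = prl f g l := FreeAbelianGroup.lift_apply_of _ _

lemma psh_cns (g : P → Q) (x : P) (e) : psh g (cns x e) = cns (g x) (psh g e) := by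
  have : (psh g).comp (cns x) = (cns (g x)).comp (psh g) := by ext l; simp
  exact DFunLike.congr_fun this e

lemma psh_bd (g : P → Q) (e) : bd (psh g e) = psh g (bd e) := by
  have : bd.comp (psh g) = (psh g).comp bd := by
    ext l
    simp only [AddMonoidHom.comp_apply, psh_fo, bd_fo]
    induction l with
    | nil => simp [bdl]
    | cons x xs ih => simp [bdl, ih, psh_cns]
  exact DFunLike.congr_fun this e

lemma psh_psh {R : Type*} (g : P → Q) (f : Q → R) (e) : psh f (psh g e) = psh (f ∘ g) e := by
  have : (psh f).comp (psh g) = psh (f ∘ g) := by ext l; simp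
  exact DFunLike.congr_fun this e

lemma psh_id (e : Ch P) : psh id e = e := by
  have : psh id = AddMonoidHom.id (Ch P) := by ext l; simp
  exact DFunLike.congr_fun this e

lemma pr_cns (f g : P → Q) (x : P) (e) : pr f g (cns x e) = cns (f x) (cns (g x) (psh g e)) - cns (f x) (pr f g e) := by
  have : (pr f g).comp (cns x) = (cns (f x)).comp ((cns (g x)).comp (psh g)) - (cns (f x)).comp (pr f g) := by
    ext l; simp [prl]
  exact DFunLike.congr_fun this e

lemma bd_bd (e : Ch P) : bd (bd e) = 0 := by
  have : (bd.comp bd : Ch P →+ Ch P) = 0 := by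
    ext l
    simp only [AddMonoidHom.comp_apply, bd_fo, AddMonoidHom.zero_apply]
    induction l with
    | nil => simp [bdl]
    | cons x xs ih => simp [bdl, ih, bd_cns]
  exact DFunLike.congr_fun this e

lemma pr_bd (f g : P → Q) (e) : bd (pr f g e) + pr f g (bd e) = psh g e - psh f e := by
  have : bd.comp (pr f g) + (pr f g).comp bd = psh g - psh f := by
    ext l
    simp only [AddMonoidHom.comp_apply, AddMonoidHom.add_apply, AddMonoidHom.sub_apply, bd_fo, psh_fo, pr_fo]
    induction l with
    | nil => simp [bdl, prl]
    | cons x xs ih =>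
      have h : bd (prl f g xs) = fo (xs.map g) - fo (xs.map f) - pr f g (bdl xs) := by rw [← ih]; abel
      have h2 : bdl (xs.map g) = psh g (bdl xs) := by
        have := psh_bd g (fo xs); simpa using this
      simp only [prl, bdl, map_sub, bd_fo, bd_cns, h, pr_cns, h2, pr_fo, cns_fo, List.map_cons]
      abel
  exact DFunLike.congr_fun this e

lemma prl_mem (f g : P → Q) (l : List P) : prl f g l ∈ Hm (fun l' => ∀ y ∈ l', ∃ x ∈ l, y = f x ∨ y = g x) (l.length + 1) := by
  induction l with
  | nil => simp [prl]
  | cons x xs ih =>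
    rw [prl]
    refine sub_mem (Hm_fo' ?_ (by simp)) (Hm_map (cns (f x)) _ ?_ ih)
    · intro y hy
      simp only [List.mem_cons, List.mem_map] at hy
      rcases hy with rfl | rfl | ⟨z, hz, rfl⟩
      · exact ⟨x, by simp, Or.inl rfl⟩
      · exact ⟨x, by simp, Or.inr rfl⟩
      · exact ⟨z, by simp [hz], Or.inr rfl⟩
    · intro l hl hh
      rw [cns_fo]
      refine Hm_fo' ?_ (by simp [hl])
      intro y hy
      simp only [List.mem_cons] at hy
      rcases hy with rfl | hy
      · exact ⟨x, by simp, Or.inl rfl⟩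
      · obtain ⟨z, hz, h⟩ := hh y hy
        exact ⟨z, by simp [hz], h⟩

lemma psh_mem (g : P → Q) {Sm : List P → Prop} {Sm' : List Q → Prop} (h : ∀ l, Sm l → Sm' (l.map g)) {n e} (he : e ∈ Hm Sm n) :
    psh g e ∈ Hm Sm' n :=
  Hm_map (psh g) _ (fun l hl hS => by rw [psh_fo]; exact Hm_fo' (h l hS) (by simp [hl])) he
end Prism

section Fill
variable {V : Type*} [NormedAddCommGroup V] [NormedSpace ℝ V]

/-- small lists -/
def Sml (A : Set V) (η : ℝ) (l : List V) : Prop := (∀ x ∈ l, x ∈ A) ∧ ∀ x ∈ l, ∀ y ∈ l, dist x y < η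

lemma Sml_sub {A : Set V} {η} (l l' : List V) (h : Sml A η l) (hs : l'.Sublist l) : Sml A η l' :=
  ⟨fun x hx => h.1 x (hs.subset hx), fun x hx y hy => h.2 x (hs.subset hx) y (hs.subset hy)⟩

lemma fill (A : Set V) (c : V) (hc : c ∈ A) (hst : ∀ x ∈ A, ∀ t : ℝ, 0 ≤ t → t ≤ 1 → (1 - t) • x + t • c ∈ A)
    (R : ℝ) (hR : ∀ x ∈ A, dist x c ≤ R) (ρ η : ℝ) (hρ0 : 0 < ρ) (hρ : ρ < η) (n : ℕ) (e : Ch V) (he : e ∈ Hm (Sml A ρ) n)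
    (hb : bd e = 0) : ∃ e' ∈ Hm (Sml A η) (n+1), bd e' = e := by
  obtain ⟨M, hM⟩ := exists_nat_gt (R / (η - ρ))
  have hηρ : 0 < η - ρ := by linarith
  have hR0 : 0 ≤ R := le_trans dist_nonneg (hR c hc)
  have hM0 : (0:ℝ) < M := lt_of_le_of_lt (by positivity) hM
  have hM1 : R / M < η - ρ := by rw [div_lt_iff₀ hM0]; rw [div_lt_iff₀ hηρ] at hM; linarith
  let h : ℕ → V → V := fun k x => (1 - (k:ℝ)/M) • x + ((k:ℝ)/M) • c
  have key1 : ∀ t : ℝ, 0 ≤ t → t ≤ 1 → ∀ x y, dist x y < ρ → dist ((1-t) • x + t • c) ((1-t) • y + t • c) < ρ := by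
    intro t h0 h1 x y hxy
    rw [dist_add_right, dist_smul₀, Real.norm_of_nonneg (by linarith)]
    nlinarith [dist_nonneg (x := x) (y := y)]
  have key2 : ∀ t t' : ℝ, 0 ≤ t → t ≤ 1 → t' = t + 1/M → ∀ x y, y ∈ A → dist x y < ρ → 
      dist ((1-t) • x + t • c) ((1-t') • y + t' • c) < η := by
    intro t t' h0 h1 ht x y hyA hxy
    have h2 := key1 t h0 h1 x y hxy
    have h3 : dist ((1-t) • y + t • c) ((1-t') • y + t' • c) ≤ R/M := by
      rw [dist_eq_norm, show (1-t) • y + t • c - ((1-t') • y + t' • c) = (1/(M:ℝ)) • (y - c) by subst ht; module, norm_smul,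
        Real.norm_of_nonneg (by positivity), ← dist_eq_norm]
      have := hR y hyA
      rw [div_mul_eq_mul_div, one_mul]
      gcongr
    have := dist_triangle ((1-t) • x + t • c) ((1-t) • y + t • c) ((1-t') • y + t' • c)
    linarith
  have hmem : ∀ k < M, pr (h k) (h (k+1)) e ∈ Hm (Sml A η) (n+1) := by
    intro k hk
    have hk0 : (0:ℝ) ≤ k / M := by positivity
    have hk1 : ((k+1 : ℕ):ℝ) / M ≤ 1 := by rw [div_le_one hM0]; exact_mod_cast hk
    have hk2 : ((k+1 : ℕ):ℝ) / M = (k:ℝ)/M + 1/M := by push_cast; ring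
    have hM' : 0 < 1 / (M:ℝ) := by positivity
    refine Hm_map (pr (h k) (h (k+1))) _ ?_ he
    intro l hl hS
    rw [pr_fo, ← hl]
    refine Hm_mono ?_ (prl_mem _ _ l)
    intro l' hl'
    refine ⟨?_, ?_⟩
    · intro y hy
      obtain ⟨x, hx, rfl | rfl⟩ := hl' y hy
      · exact hst x (hS.1 x hx) _ hk0 (by linarith)
      · exact hst x (hS.1 x hx) _ (by linarith) hk1
    · intro y hy y' hy'
      obtain ⟨x, hx, rfl | rfl⟩ := hl' y hy <;> obtain ⟨x', hx', rfl | rfl⟩ := hl' y' hy'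
      · exact (key1 _ hk0 (by linarith) x x' (hS.2 x hx x' hx')).trans hρ
      · exact key2 _ _ hk0 (by linarith) hk2 x x' (hS.1 x' hx') (hS.2 x hx x' hx')
      · rw [dist_comm]
        exact key2 _ _ hk0 (by linarith) hk2 x' x (hS.1 x hx) (hS.2 x' hx' x hx)
      · exact (key1 _ (by linarith) hk1 x x' (hS.2 x hx x' hx')).trans hρ
  have hsum : bd (∑ k ∈ Finset.range M, pr (h k) (h (k+1)) e) = psh (h M) e - psh (h 0) e := by
    rw [map_sum, ← Finset.sum_range_sub (fun k => psh (h k) e)]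
    refine Finset.sum_congr rfl fun k _ => ?_
    have := pr_bd (h k) (h (k+1)) e
    rw [hb, map_zero, add_zero] at this
    exact this
  have h0 : h 0 = id := by ext x; simp [h]
  have hM : h M = fun _ => c := by ext x; simp [h, hM0.ne']
  refine ⟨cns c (psh (fun _ => c) e) - ∑ k ∈ Finset.range M, pr (h k) (h (k+1)) e, sub_mem ?_ (sum_mem fun k hk => hmem k (Finset.mem_range.1 hk)), ?_⟩
  · refine Hm_map ((cns c).comp (psh (fun _ => c))) _ ?_ he
    intro l hl hS
    simp only [AddMonoidHom.comp_apply, psh_fo, cns_fo]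
    refine Hm_fo' ⟨?_, ?_⟩ (by simp [hl])
    · intro x hx; simp at hx; rcases hx with rfl | ⟨_, rfl⟩ <;> exact hc
    · have hx : ∀ x ∈ c :: List.map (fun _ => c) l, x = c := by
        intro x hx; simp at hx; rcases hx with rfl | ⟨_, rfl⟩ <;> rfl
      intro x h1 y h2; rw [hx x h1, hx y h2, dist_self]; linarith
  · rw [map_sub, hsum, bd_cns, psh_bd, hb, map_zero, map_zero, sub_zero, h0, hM, psh_id]; abel
end Fill

section Sphere
variable {n : ℕ}
/-- the ℓ1 sphere -/
def Sph (n : ℕ) : Set (Fin n → ℝ) := {x | ∑ i, |x i| = 1}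
/-- hemispheres -/
def Hem (n : ℕ) (k : Fin n) : Set (Fin n → ℝ) := {x | x ∈ Sph n ∧ (∀ j, k < j → x j = 0) ∧ 0 ≤ x k}

lemma Sph_le {x : Fin n → ℝ} (h : x ∈ Sph n) (i) : |x i| ≤ 1 := by
  rw [← (show ∑ i, |x i| = 1 from h)]
  exact Finset.single_le_sum (f := fun i => |x i|) (fun i _ => abs_nonneg _) (Finset.mem_univ i)

lemma Sph_neg {x : Fin n → ℝ} (h : x ∈ Sph n) : -x ∈ Sph n := by simpa [Sph] using h

lemma Hem_single (k : Fin n) : Pi.single k 1 ∈ Hem n k := by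
  refine ⟨?_, ?_, ?_⟩
  · simp only [Sph, Set.mem_setOf_eq]
    rw [Finset.sum_eq_single k] <;> simp +contextual [Pi.single_apply]
  · intro j hj; simp [Pi.single_apply, hj.ne']
  · simp

lemma Hem_star (k : Fin n) (x) (hx : x ∈ Hem n k) (t : ℝ) (h0 : 0 ≤ t) (h1 : t ≤ 1) : (1 - t) • x + t • Pi.single k 1 ∈ Hem n k := by
  obtain ⟨a, b, c⟩ := hx
  refine ⟨?_, ?_, ?_⟩
  · simp only [Sph, Set.mem_setOf_eq] at a ⊢
    have : ∀ i, |((1 - t) • x + t • (Pi.single k 1 : Fin n → ℝ)) i| = (1-t) * |x i| + t * (if i = k then 1 else 0) := by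
      intro i
      by_cases h : i = k
      · subst h
        simp
        rw [abs_of_nonneg c, abs_of_nonneg (by nlinarith)]
      · simp [Pi.single_apply, h, abs_mul]
        left; linarith
    simp_rw [this]
    rw [Finset.sum_add_distrib, ← Finset.mul_sum, ← Finset.mul_sum, a]
    simp
  · intro j hj; simp [Pi.single_apply, hj.ne', b j hj]
  · simp; nlinarith

lemma Hem_R (k : Fin n) (x) (hx : x ∈ Hem n k) : dist x (Pi.single k 1) ≤ 2 := by
  rw [dist_pi_le_iff (by norm_num)]
  intro i
  have h1 := Sph_le hx.1 i
  have h2 := Sph_le (Hem_single k).1 i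
  rw [Real.dist_eq]
  have := abs_sub (x i) ((Pi.single k 1 : Fin n → ℝ) i)
  linarith

lemma chain_exists (N : ℕ) (hN : N < n) (η : ℝ) (hη : 0 < η) : ∃ e : ℕ → Ch (Fin n → ℝ),
    e 0 = fo [Pi.single ⟨0, by omega⟩ 1] ∧ (∀ i (h : i ≤ N), e i ∈ Hm (Sml (Hem n ⟨i, by omega⟩) η) (i+1)) ∧
    ∀ i, i + 1 ≤ N → bd (e (i+1)) = e i + sg (i+1) • psh (fun x => -x) (e i) := by
  induction N generalizing η with
  | zero =>
    refine ⟨fun _ => fo [Pi.single ⟨0, by omega⟩ 1], rfl, ?_, by omega⟩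
    intro i hi
    obtain rfl : i = 0 := by omega
    refine Hm_fo' ⟨?_, ?_⟩ (by simp)
    · intro x hx; simp at hx; subst hx; exact Hem_single _
    · intro x hx y hy; simp at hx hy; subst hx hy; simpa using hη
  | succ N ih =>
    obtain ⟨e, h0, h1, h2⟩ := ih (by omega) (η/2) (by linarith)
    have hnn : ∀ c : Ch (Fin n → ℝ), psh (fun x => -x) (psh (fun x => -x) c) = c := by
      intro c; rw [psh_psh, show ((fun x : Fin n → ℝ => -x) ∘ fun x => -x) = id by ext; simp, psh_id]
    have hcyc : bd (e N + sg (N+1) • psh (fun x => -x) (e N)) = 0 := by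
      rw [map_add, map_zsmul, psh_bd]
      rcases N with _ | N
      · rw [h0]; simp [bdl, sg_one]
      · rw [h2 N le_rfl, map_add, map_zsmul, hnn]
        push_cast
        rw [sg_add (N+1), sg_one]
        rcases sg_cases (N+1) with h | h <;> rw [h] <;> simp <;> abel
    have hmem : e N + sg (N+1) • psh (fun x => -x) (e N) ∈ Hm (Sml (Hem n ⟨N+1, hN⟩) (η/2)) (N+1) := by
      refine add_mem (Hm_mono ?_ (h1 N le_rfl)) (zsmul_mem (psh_mem _ ?_ (h1 N le_rfl)) _)
      · rintro l ⟨ha, hb⟩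
        refine ⟨fun x hx => ⟨(ha x hx).1, fun j hj => (ha x hx).2.1 j (lt_trans (by simp [Fin.lt_def]) hj), ?_⟩, hb⟩
        exact ((ha x hx).2.1 ⟨N+1, hN⟩ (by simp [Fin.lt_def])).ge
      · rintro l ⟨ha, hb⟩
        refine ⟨?_, ?_⟩
        · intro x hx
          simp only [List.mem_map] at hx
          obtain ⟨x, hx, rfl⟩ := hx
          refine ⟨Sph_neg (ha x hx).1, fun j hj => ?_, ?_⟩
          · simp [(ha x hx).2.1 j (lt_trans (by simp [Fin.lt_def]) hj)]
          · simp [(ha x hx).2.1 ⟨N+1, hN⟩ (by simp [Fin.lt_def])]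
        · intro x hx y hy
          simp only [List.mem_map] at hx hy
          obtain ⟨x, hx, rfl⟩ := hx
          obtain ⟨y, hy, rfl⟩ := hy
          rw [dist_neg_neg]; exact hb x hx y hy
    obtain ⟨e', he', hb'⟩ := fill (Hem n ⟨N+1, hN⟩) _ (Hem_single _) (Hem_star _) 2 (Hem_R _) (η/2) η (by linarith) (by linarith) _ _ hmem hcyc
    refine ⟨fun i => if i ≤ N then e i else e', by simp [h0], ?_, ?_⟩
    · intro i hi
      by_cases h : i ≤ N
      · simp only [h, if_true]
        refine Hm_mono ?_ (h1 i h)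
        rintro l ⟨ha, hb⟩
        exact ⟨ha, fun x hx y hy => by linarith [hb x hx y hy]⟩
      · obtain rfl : i = N + 1 := by omega
        simpa using he'
    · intro i hi
      by_cases h : i + 1 ≤ N
      · simp only [h, if_true, show i ≤ N by omega]
        exact h2 i h
      · obtain rfl : i = N := by omega
        simpa using hb'
end Sphere
end

set_option linter.unusedSimpArgs false
set_option linter.unusedVariables false
noncomputable section
open Lb (f1 f2 tw kp)

section Lab
variable {P : Type*} [MetricSpace P] [CompactSpace P]

lemma pos_min {X : Type*} [TopologicalSpace X] [CompactSpace X] (g : X → ℝ) (hg : Continuous g) (hp : ∀ x, 0 < g x) :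
    ∃ c, 0 < c ∧ ∀ x, c ≤ g x := by
  rcases isEmpty_or_nonempty X with h | h
  · exact ⟨1, one_pos, fun x => h.elim x⟩
  · obtain ⟨x, -, hx⟩ := isCompact_univ.exists_isMinOn Set.univ_nonempty hg.continuousOn
    exact ⟨g x, hp x, fun y => hx (Set.mem_univ y)⟩

open Classical in
/-- sign -/
def sb (r : ℝ) : Bool := decide (0 < r)

lemma sb_neg {r : ℝ} (h : r ≠ 0) : sb (-r) = !sb r := by
  unfold sb
  rcases lt_or_gt_of_ne h with h | h
  · simp [h, h.le]
  · simp [h, h.le]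

lemma sb_far {c r r' : ℝ} (hc : 0 < c) (h : c ≤ |r|) (h' : c ≤ |r'|) (hs : sb r' = !sb r) : c ≤ |r - r'| := by
  unfold sb at hs
  by_cases h1 : 0 < r
  · have h2 : ¬ 0 < r' := by simpa [h1] using hs
    rw [abs_of_pos h1] at h
    exact le_trans (by linarith) (le_abs_self _)
  · have h2 : 0 < r' := by simpa [h1] using hs
    rw [abs_of_pos h2] at h'
    rw [abs_sub_comm]
    exact le_trans (by linarith) (le_abs_self _)

variable (ng : P → P) (a b : ℕ) (u χ : ℕ → P → P → ℝ) (c : ℝ)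

/-- large χ indices -/
def Js (x y : P) : Set ℕ := {j | j < b ∧ c ≤ |χ j x y|}
/-- large u indices -/
def Us (x y : P) : Set ℕ := {l | l < a ∧ (c ≤ |u l x y| ∨ c ≤ |u l y x|)}
/-- tie break -/
def tb (x y : P) : Prop := WellOrderingRel ({x, ng x} : Set P) {y, ng y}
/-- choose first coordinate -/
def pk (l : ℕ) (x y : P) : Prop := c ≤ |u l x y| ∧ (c ≤ |u l y x| → tb ng x y)

open Classical in
/-- the labelling -/
def lb (x y : P) : Lb :=
  if (Js b χ c x y).Nonempty then Lb.c (sInf (Js b χ c x y)) (sb (χ (sInf (Js b χ c x y)) x y))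
  else if pk ng u c (sInf (Us a u c x y)) x y then
    Lb.x (sInf (Us a u c x y)) (sb (u (sInf (Us a u c x y)) x y))
  else Lb.y (sInf (Us a u c x y)) (sb (u (sInf (Us a u c x y)) y x))

lemma lab_exists (hng : ∀ x, ng (ng x) = x) (hb : 0 < b)
    (hu : ∀ l < a, Continuous (fun p : P × P => u l p.1 p.2))
    (hχ : ∀ j < b, Continuous (fun p : P × P => χ j p.1 p.2))
    (u1 : ∀ l x y, u l (ng x) y = - u l x y) (u2 : ∀ l x y, u l x (ng y) = u l x y)
    (c1 : ∀ j x y, χ j (ng x) y = - χ j x y) (cs : ∀ j x y, χ j y x = χ j x y)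
    (hz : ∀ x y, (∃ l < a, u l x y ≠ 0 ∨ u l y x ≠ 0) ∨ ∃ j < b, χ j x y ≠ 0)
    (hd : ∀ x, 0 < χ 0 x x) :
    ∃ lab η, 0 < η ∧ LabD ng lab (fun l => ∀ x ∈ l, ∀ y ∈ l, dist x y < η) a b := by
  have c2 : ∀ j x y, χ j x (ng y) = - χ j x y := by
    intro j x y; rw [cs, c1, cs]
  let Φ : P × P → (Fin a → ℝ) × (Fin b → ℝ) := fun p => (fun l => u l p.1 p.2, fun j => χ j p.1 p.2)
  have hΦ : Continuous Φ := by
    refine Continuous.prodMk (continuous_pi fun l => hu l l.2) (continuous_pi fun j => hχ j j.2)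
  obtain ⟨d1, hd1, hd1'⟩ := pos_min (fun x => χ 0 x x) ((hχ 0 hb).comp (continuous_id.prodMk continuous_id)) hd
  obtain ⟨d2, hd2, hd2'⟩ := pos_min (fun p : P × P => max ‖Φ p‖ ‖Φ p.swap‖)
    (hΦ.norm.max (hΦ.comp continuous_swap).norm) (by
      rintro ⟨x, y⟩
      rw [lt_max_iff, norm_pos_iff, norm_pos_iff]
      by_contra hcon
      push Not at hcon
      obtain ⟨e1, e2⟩ := hcon
      have e1 := Prod.ext_iff.1 e1
      have e2 := Prod.ext_iff.1 e2
      rcases hz x y with ⟨l, hl, h | h⟩ | ⟨j, hj, h⟩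
      · exact h (congrFun e1.1 ⟨l, hl⟩)
      · exact h (congrFun e2.1 ⟨l, hl⟩)
      · exact h (congrFun e1.2 ⟨j, hj⟩))
  obtain ⟨c, hc, hcd1, hcd2⟩ : ∃ c, 0 < c ∧ c ≤ d1 ∧ c ≤ d2 := ⟨min d1 d2, lt_min hd1 hd2, min_le_left _ _, min_le_right _ _⟩
  have hdiag : ∀ x, 0 ∈ Js b χ c x x := fun x => ⟨hb, (hcd1.trans (hd1' x)).trans (le_abs_self _)⟩
  have hnon : ∀ x y, (Js b χ c x y).Nonempty ∨ (Us a u c x y).Nonempty := by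
    intro x y
    by_contra hcon
    push Not at hcon
    obtain ⟨h1, h2⟩ := hcon
    have h1 : ∀ j, j < b → |χ j x y| < c := by
      intro j hj; by_contra h; push Not at h
      have : j ∈ Js b χ c x y := ⟨hj, h⟩
      rw [h1] at this; exact this
    have h2 : ∀ l, l < a → |u l x y| < c ∧ |u l y x| < c := by
      intro j hj; by_contra h
      have : j ∈ Us a u c x y := ⟨hj, by by_contra h'; push Not at h'; exact h h'⟩
      rw [h2] at this; exact this
    have := hcd2.trans (hd2' (x, y))
    refine absurd this (not_le.2 (max_lt ?_ ?_))
    · rw [Prod.norm_def, max_lt_iff, pi_norm_lt_iff hc, pi_norm_lt_iff hc]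
      exact ⟨fun l => (h2 l l.2).1, fun j => h1 j j.2⟩
    · rw [Prod.norm_def, max_lt_iff, pi_norm_lt_iff hc, pi_norm_lt_iff hc]
      exact ⟨fun l => (h2 l l.2).2, fun j => by
        have := h1 j j.2
        rw [← cs] at this
        exact this⟩
  have J1 : ∀ x y, Js b χ c (ng x) y = Js b χ c x y := by intro x y; simp [Js, c1]
  have J2 : ∀ x y, Js b χ c x (ng y) = Js b χ c x y := by intro x y; simp [Js, c2]
  have J3 : ∀ x y, Js b χ c y x = Js b χ c x y := by intro x y; simp only [Js, cs _ x y]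
  have U1 : ∀ x y, Us a u c (ng x) y = Us a u c x y := by intro x y; simp [Us, u1, u2]
  have U2 : ∀ x y, Us a u c x (ng y) = Us a u c x y := by intro x y; simp [Us, u1, u2]
  have U3 : ∀ x y, Us a u c y x = Us a u c x y := by intro x y; simp only [Us, or_comm]
  have T1 : ∀ x y, tb ng (ng x) y = tb ng x y := by intro x y; simp only [tb, hng, Set.pair_comm x]
  have T2 : ∀ x y, tb ng x (ng y) = tb ng x y := by intro x y; simp only [tb, hng, Set.pair_comm y]
  have K1 : ∀ l x y, pk ng u c l (ng x) y = pk ng u c l x y := by intro l x y; simp [pk, u1, u2, T1]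
  have K2 : ∀ l x y, pk ng u c l x (ng y) = pk ng u c l x y := by intro l x y; simp [pk, u1, u2, T2]
  have T3 : ∀ x y, ¬ (Js b χ c x y).Nonempty → (tb ng y x ↔ ¬ tb ng x y) := by
    intro x y hJ
    have hne : ({x, ng x} : Set P) ≠ {y, ng y} := by
      intro h
      have : x ∈ ({y, ng y} : Set P) := by rw [← h]; simp
      apply hJ
      rcases this with rfl | rfl
      · exact ⟨0, hdiag _⟩
      · rw [J1]; exact ⟨0, hdiag _⟩
    unfold tb
    constructor
    · intro h h'; exact asymm_of WellOrderingRel h h'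
    · intro h
      rcases trichotomous_of WellOrderingRel ({x, ng x} : Set P) {y, ng y} with h' | h' | h'
      · exact absurd h' h
      · exact absurd h' hne
      · exact h'
  have K3 : ∀ x y, ¬ (Js b χ c x y).Nonempty → (pk ng u c (sInf (Us a u c x y)) y x ↔ ¬ pk ng u c (sInf (Us a u c x y)) x y) := by
    intro x y hJ
    have hm := Nat.sInf_mem ((hnon x y).resolve_left hJ)
    have := T3 x y hJ
    have hm := hm.2
    unfold pk
    tauto
  have spJ : ∀ x y, (h : (Js b χ c x y).Nonempty) → χ (sInf (Js b χ c x y)) x y ≠ 0 := by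
    intro x y h h'
    have := (Nat.sInf_mem h).2
    rw [h'] at this; simp at this; linarith
  have spX : ∀ x y l, pk ng u c l x y → u l x y ≠ 0 := by
    intro x y l h h'
    have := h.1
    rw [h'] at this; simp at this; linarith
  have spY : ∀ x y, ¬ (Js b χ c x y).Nonempty → ¬ pk ng u c (sInf (Us a u c x y)) x y → c ≤ |u (sInf (Us a u c x y)) y x| := by
    intro x y h h'
    rw [← K3 x y h] at h'
    exact h'.1
  have hspec : ∀ x y, (∃ j < b, lb ng a b u χ c x y = Lb.c j (sb (χ j x y)) ∧ c ≤ |χ j x y|) ∨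
      (∃ l < a, lb ng a b u χ c x y = Lb.x l (sb (u l x y)) ∧ c ≤ |u l x y|) ∨
      (∃ l < a, lb ng a b u χ c x y = Lb.y l (sb (u l y x)) ∧ c ≤ |u l y x|) := by
    intro x y
    by_cases hJ : (Js b χ c x y).Nonempty
    · left
      have := Nat.sInf_mem hJ
      exact ⟨_, this.1, by rw [lb, if_pos hJ], this.2⟩
    · have hU := Nat.sInf_mem ((hnon x y).resolve_left hJ)
      right
      by_cases hp : pk ng u c (sInf (Us a u c x y)) x y
      · left
        exact ⟨_, hU.1, by rw [lb, if_neg hJ, if_pos hp], hp.1⟩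
      · right
        exact ⟨_, hU.1, by rw [lb, if_neg hJ, if_neg hp], spY x y hJ hp⟩
  obtain ⟨η, hη, hηΦ⟩ := Metric.uniformContinuous_iff.1 (CompactSpace.uniformContinuous_of_continuous hΦ) c hc
  have close : ∀ x y x' y', dist x x' < η → dist y y' < η → (∀ l < a, |u l x y - u l x' y'| < c) ∧ ∀ j < b, |χ j x y - χ j x' y'| < c := by
    intro x y x' y' h h'
    have := hηΦ (a := (x, y)) (b := (x', y')) (by rw [Prod.dist_eq]; exact max_lt h h')
    rw [Prod.dist_eq, max_lt_iff, dist_pi_lt_iff hc, dist_pi_lt_iff hc] at this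
    exact ⟨fun l hl => this.1 ⟨l, hl⟩, fun j hj => this.2 ⟨j, hj⟩⟩
  refine ⟨lb ng a b u χ c, η, hη, ?_, ?_, ?_, ?_, ?_, ?_, ?_⟩
  · intro x y
    unfold lb
    rw [J1, U1, K1]
    split_ifs with h h'
    · rw [c1, sb_neg (spJ _ _ h)]; rfl
    · rw [u1, sb_neg (spX _ _ _ h')]; rfl
    · rw [u2]; rfl
  · intro x y
    unfold lb
    rw [J2, U2, K2]
    split_ifs with h h'
    · rw [c2, sb_neg (spJ _ _ h)]; rfl
    · rw [u2]; rfl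
    · rw [u1, sb_neg]; rfl
      intro h0
      have := spY x y h h'
      rw [h0] at this; simp at this; linarith
  · intro x y
    unfold lb
    rw [J3, U3]
    by_cases h : (Js b χ c x y).Nonempty
    · rw [if_pos h, if_pos h, cs]; rfl
    · rw [if_neg h, if_neg h]
      have := K3 x y h
      by_cases h' : pk ng u c (sInf (Us a u c x y)) x y
      · rw [if_pos h', if_neg (by tauto)]; rfl
      · rw [if_neg h', if_pos (by tauto)]; rfl
  · intro l l' hl hs x hx y hy
    exact hl x (hs.subset hx) y (hs.subset hy)
  · intro xs ys hxs hys x hx y hy x' hx' y' hy' hcon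
    have cl := close x y x' y' (hxs x hx x' hx') (hys y hy y' hy')
    have cl' := close y x y' x' (hys y hy y' hy') (hxs x hx x' hx')
    rcases hspec x y with ⟨j, hj, e, h⟩ | ⟨j, hj, e, h⟩ | ⟨j, hj, e, h⟩ <;>
    rcases hspec x' y' with ⟨j', hj', e', h'⟩ | ⟨j', hj', e', h'⟩ | ⟨j', hj', e', h'⟩ <;>
    rw [e, e'] at hcon <;> simp [Lb.neg] at hcon
    · obtain ⟨rfl, hs⟩ := hcon
      exact absurd (sb_far hc h h' hs) (not_le.2 (cl.2 _ hj))
    · obtain ⟨rfl, hs⟩ := hcon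
      exact absurd (sb_far hc h h' hs) (not_le.2 (cl.1 _ hj))
    · obtain ⟨rfl, hs⟩ := hcon
      exact absurd (sb_far hc h h' hs) (not_le.2 (cl'.1 _ hj))
  · intro xs hxs x hx
    have h0 := hdiag x
    have : sInf (Js b χ c x x) = 0 := Nat.sInf_eq_zero.2 (Or.inl h0)
    rw [lb, if_pos ⟨0, h0⟩, this]
    simp [sb, hd]
  · intro xs ys hxs hys x hx y hy
    rcases hspec x y with ⟨j, hj, e, h⟩ | ⟨j, hj, e, h⟩ | ⟨j, hj, e, h⟩ <;> rw [e] <;> exact hj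
end Lab
end

set_option linter.unusedSimpArgs false
set_option linter.unusedVariables false
noncomputable section

lemma Sph_compact (n : ℕ) : IsCompact (Sph n) := by
  refine Metric.isCompact_of_isClosed_isBounded ?_ ?_
  · exact isClosed_eq (by fun_prop) continuous_const
  · refine (Metric.isBounded_closedBall (x := (0 : Fin n → ℝ)) (r := 1)).subset ?_
    intro x hx
    rw [mem_closedBall_zero_iff, pi_norm_le_iff_of_nonneg zero_le_one]
    exact fun i => Sph_le hx i

lemma top_main (n a b h : ℕ) (hn : a + h < n) (hcase : ¬ ∃ α β, NumD b h α β) (hb : 0 < b)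
    (u χ : ℕ → (Fin n → ℝ) → (Fin n → ℝ) → ℝ)
    (hu : ∀ l < a, Continuous (fun p : (Fin n → ℝ) × (Fin n → ℝ) => u l p.1 p.2))
    (hχ : ∀ j < b, Continuous (fun p : (Fin n → ℝ) × (Fin n → ℝ) => χ j p.1 p.2))
    (u1 : ∀ l x y, u l (-x) y = - u l x y) (u2 : ∀ l x y, u l x (-y) = u l x y)
    (c1 : ∀ j x y, χ j (-x) y = - χ j x y) (cs : ∀ j x y, χ j y x = χ j x y)
    (hz : ∀ x ∈ Sph n, ∀ y ∈ Sph n, (∃ l < a, u l x y ≠ 0 ∨ u l y x ≠ 0) ∨ ∃ j < b, χ j x y ≠ 0)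
    (hd : ∀ x ∈ Sph n, 0 < χ 0 x x) : False := by
  haveI : CompactSpace (Sph n) := isCompact_iff_compactSpace.1 (Sph_compact n)
  let ng : Sph n → Sph n := fun x => ⟨-x.1, Sph_neg x.2⟩
  have hvv : Continuous (fun p : Sph n × Sph n => ((p.1 : Fin n → ℝ), (p.2 : Fin n → ℝ))) := by fun_prop
  obtain ⟨lab, η, hη, H⟩ := lab_exists (P := Sph n) ng a b (fun l x y => u l x y) (fun j x y => χ j x y)
    (fun x => Subtype.ext (neg_neg _)) hb (fun l hl => (hu l hl).comp hvv) (fun l hl => (hχ l hl).comp hvv)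
    (fun l x y => u1 _ _ _) (fun l x y => u2 _ _ _) (fun l x y => c1 _ _ _) (fun l x y => cs _ _ _)
    (fun x y => hz x x.2 y y.2) (fun x => hd x x.2)
  obtain ⟨e, h0, h1, h2⟩ := chain_exists (n := n) (a + h) hn η hη
  have hs0 : (Pi.single ⟨0, by omega⟩ 1 : Fin n → ℝ) ∈ Sph n := (Hem_single _).1
  classical
  let r : (Fin n → ℝ) → Sph n := fun x => if hx : x ∈ Sph n then ⟨x, hx⟩ else ⟨_, hs0⟩
  have hr : ∀ x (hx : x ∈ Sph n), r x = ⟨x, hx⟩ := fun x hx => dif_pos hx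
  have hrr : ∀ i ≤ a + h, psh r (psh (fun x => -x) (e i)) = psh ng (psh r (e i)) := by
    intro i hi
    have := Hm_ext ((psh r).comp (psh (fun x => -x))) ((psh ng).comp (psh r)) (fun l hl hS => by
      simp only [AddMonoidHom.comp_apply, psh_fo, List.map_map]
      congr 1
      refine List.map_congr_left fun x hx => ?_
      have hx := (hS.1 x hx).1
      simp only [Function.comp_apply]
      rw [hr x hx, hr _ (Sph_neg hx)]) (h1 i hi)
    exact this
  obtain ⟨z, hz⟩ := H.fam (a + h) (fun i => psh r (e i)) (by
      intro i hi
      refine psh_mem r ?_ (h1 i hi)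
      intro l hS x hx y hy
      simp only [List.mem_map] at hx hy
      obtain ⟨x, hx, rfl⟩ := hx
      obtain ⟨y, hy, rfl⟩ := hy
      rw [hr x (hS.1 x hx).1, hr y (hS.1 y hy).1, Subtype.dist_eq]
      exact hS.2 x hx y hy) (by simp [h0, bdl]) (by
      intro i hi
      rw [psh_bd, h2 i hi, map_add, map_zsmul, hrr i (by omega)]) (by simp [h0, EZ_nil])
  have hz : FamL a b ((h:ℤ) + a) z := by convert hz using 1; push_cast; ring
  obtain ⟨z', hz'⟩ := peel_all a b h z hz
  exact hcase (num_of_fam b h z' hz')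
end

set_option linter.unusedSimpArgs false
set_option linter.unusedVariables false
noncomputable section
variable {n d : ℕ}

/-- positive part -/
def pp (x : Fin n → ℝ) (i : Fin n) : ℝ := max (x i) 0

lemma pp_nonneg (x : Fin n → ℝ) (i) : 0 ≤ pp x i := le_max_right _ _
lemma pp_pos (x : Fin n → ℝ) (i) : 0 < pp x i ↔ 0 < x i := by simp [pp]
lemma pp_mul_neg (x : Fin n → ℝ) (i) : pp x i * pp (-x) i = 0 := by
  rcases le_total (x i) 0 with h | h <;> simp [pp, h]
lemma pp_sub (x : Fin n → ℝ) (i) : pp x i - pp (-x) i = x i := by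
  rcases le_total (x i) 0 with h | h <;> simp [pp, h]
lemma pp_add (x : Fin n → ℝ) (i) : pp x i + pp (-x) i = |x i| := by
  rcases le_total (x i) 0 with h | h <;> simp [pp, h, abs_of_nonneg, abs_of_nonpos]
lemma pp_cont : Continuous (pp : (Fin n → ℝ) → Fin n → ℝ) :=
  continuous_pi fun i => by unfold pp; fun_prop

/-- positive support -/
def ps (x : Fin n → ℝ) : Finset (Fin n) := Finset.univ.filter fun i => 0 < pp x i

lemma ps_disj (x : Fin n → ℝ) : Disjoint (ps x) (ps (-x)) := by
  rw [Finset.disjoint_left]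
  intro i h h'
  simp only [ps, Finset.mem_filter] at h h'
  have := pp_mul_neg x i
  exact absurd this (mul_pos h.2 h'.2).ne'

/-- weights -/
def AA (F : Finset (Finset (Fin n))) (co : Finset (Fin n) → ℕ) (j : ℕ) (x y : Fin n → ℝ) : ℝ :=
  ∑ B ∈ F.filter (fun B => co B = j), ∏ i ∈ B, (pp x i * pp y i)

lemma AA_nonneg (F : Finset (Finset (Fin n))) (co j x y) : 0 ≤ AA F co j x y :=
  Finset.sum_nonneg fun B _ => Finset.prod_nonneg fun i _ => mul_nonneg (pp_nonneg _ _) (pp_nonneg _ _)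

lemma AA_symm (F : Finset (Finset (Fin n))) (co j x y) : AA F co j y x = AA F co j x y := by
  unfold AA; simp_rw [mul_comm]

lemma AA_self (F : Finset (Finset (Fin n))) (hne : ∀ A ∈ F, A.Nonempty) (co j x) : AA F co j x (-x) = 0 := by
  refine Finset.sum_eq_zero fun B hB => ?_
  obtain ⟨i, hi⟩ := hne B (Finset.mem_filter.1 hB).1
  exact Finset.prod_eq_zero hi (pp_mul_neg x i)

lemma AA_zero (F : Finset (Finset (Fin n))) (co x y) (h : ∀ A ∈ F, AA F co (co A) x y = 0) (A) (hA : A ∈ F) : ¬ A ⊆ ps x ∩ ps y := by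
  intro hs
  have := h A hA
  unfold AA at this
  rw [Finset.sum_eq_zero_iff_of_nonneg (fun B _ => Finset.prod_nonneg fun i _ => mul_nonneg (pp_nonneg _ _) (pp_nonneg _ _))] at this
  have := this A (by simp [hA])
  refine absurd this (Finset.prod_pos fun i hi => ?_).ne'
  have := hs hi
  simp only [ps, Finset.mem_inter, Finset.mem_filter] at this
  exact mul_pos this.1.2 this.2.2

lemma AA_pos (F : Finset (Finset (Fin n))) (co j x y) (h : 0 < AA F co j x y) : ∃ A ∈ F, co A = j ∧ A ⊆ ps x ∧ A ⊆ ps y := by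
  obtain ⟨A, hA, h'⟩ := Finset.exists_ne_zero_of_sum_ne_zero h.ne'
  simp only [Finset.mem_filter] at hA
  refine ⟨A, hA.1, hA.2, ?_⟩
  rw [Finset.prod_ne_zero_iff] at h'
  constructor <;> intro i hi <;> have := h' i hi <;> simp only [ps, Finset.mem_filter, Finset.mem_univ, true_and]
  · exact lt_of_le_of_ne (pp_nonneg _ _) (Ne.symm (left_ne_zero_of_mul this))
  · exact lt_of_le_of_ne (pp_nonneg _ _) (Ne.symm (right_ne_zero_of_mul this))

lemma AA_cont (F : Finset (Finset (Fin n))) (co j) {X : Type*} [TopologicalSpace X] (f g : X → Fin n → ℝ) (hf : Continuous f) (hg : Continuous g) :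
    Continuous fun t => AA F co j (f t) (g t) := by
  unfold AA
  refine continuous_finsetSum _ fun B _ => continuous_finsetProd _ fun i _ => ?_
  exact ((continuous_apply i).comp (pp_cont.comp hf)).mul ((continuous_apply i).comp (pp_cont.comp hg))

lemma ext_exists (f : (Fin n → ℝ) → EuclideanSpace ℝ (Fin d)) (hf : ContinuousOn f (stdSimplex ℝ (Fin n))) :
    ∃ g : (Fin n → ℝ) → Fin d → ℝ, Continuous g ∧ ∀ x ∈ stdSimplex ℝ (Fin n), ∀ l, g x l = f x l := by
  have hc : IsClosed (stdSimplex ℝ (Fin n)) := isClosed_stdSimplex ℝ _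
  have hf' : Continuous (fun x : stdSimplex ℝ (Fin n) => (fun l => f x l : Fin d → ℝ)) := by
    have := hf.domRestrict
    refine continuous_pi fun l => ?_
    have h2 : Continuous fun v : EuclideanSpace ℝ (Fin d) => v l := by fun_prop
    exact h2.comp this
  obtain ⟨g, hg⟩ := ContinuousMap.exists_restrict_eq hc (⟨_, hf'⟩ : C(stdSimplex ℝ (Fin n), Fin d → ℝ))
  refine ⟨g, g.continuous, fun x hx l => ?_⟩
  have := DFunLike.congr_fun hg ⟨x, hx⟩
  exact congrFun this l

/-- difference map -/
def GG (g : (Fin n → ℝ) → Fin d → ℝ) (x : Fin n → ℝ) : Fin d → ℝ := g ((2:ℝ) • pp x) - g ((2:ℝ) • pp (-x))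

lemma GG_neg (g : (Fin n → ℝ) → Fin d → ℝ) (x) : GG g (-x) = - GG g x := by simp [GG]
lemma GG_cont (g : (Fin n → ℝ) → Fin d → ℝ) (hg : Continuous g) : Continuous (GG g) := by
  unfold GG
  have := pp_cont (n := n)
  exact (hg.comp (this.const_smul (2:ℝ))).sub (hg.comp ((this.comp continuous_neg).const_smul (2:ℝ)))

lemma pp_face (x : Fin n → ℝ) (hx : x ∈ Sph n) (h0 : ∑ i, x i = 0) : (2:ℝ) • pp x ∈ simplexFace (ps x) := by
  refine ⟨⟨?_, ?_⟩, ?_⟩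
  · intro i; simp [pp_nonneg]
  · have h1 : ∑ i, |x i| = 1 := hx
    simp_rw [← pp_add, Finset.sum_add_distrib] at h1
    simp_rw [← pp_sub x, Finset.sum_sub_distrib] at h0
    simp only [Pi.smul_apply, smul_eq_mul, ← Finset.mul_sum]
    linarith
  · intro i hi
    simp only [ps, Finset.mem_filter, Finset.mem_univ, true_and, not_lt] at hi
    simp [le_antisymm hi (pp_nonneg x i)]

lemma radon_of (f : (Fin n → ℝ) → EuclideanSpace ℝ (Fin d)) (g : (Fin n → ℝ) → Fin d → ℝ)
    (hg : ∀ x ∈ stdSimplex ℝ (Fin n), ∀ l, g x l = f x l) (x) (hx : x ∈ Sph n) (h0 : ∑ i, x i = 0) (hG : ∀ l, GG g x l = 0) :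
    IsRadonPair f (ps x) (ps (-x)) := by
  have h1 := pp_face x hx h0
  have h2 := pp_face (-x) (Sph_neg hx) (by simp [h0])
  refine ⟨ps_disj x, f ((2:ℝ) • pp x), ⟨_, h1, rfl⟩, ⟨_, h2, ?_⟩⟩
  ext l
  rw [← hg _ h1.1, ← hg _ h2.1]
  have := hG l
  simp only [GG, Pi.sub_apply] at this
  linarith

/-- sign-sum character -/
def XX (F : Finset (Finset (Fin n))) (co : Finset (Fin n) → ℕ) (j : ℕ) (x y : Fin n → ℝ) : ℝ :=
  AA F co j x y + AA F co j (-x) (-y) - AA F co j x (-y) - AA F co j (-x) y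
/-- first-sign character -/
def UU (F : Finset (Finset (Fin n))) (co : Finset (Fin n) → ℕ) (j : ℕ) (x y : Fin n → ℝ) : ℝ :=
  AA F co j x y + AA F co j x (-y) - AA F co j (-x) y - AA F co j (-x) (-y)
/-- Radon defect -/
def QQ (g : (Fin n → ℝ) → Fin d → ℝ) (x : Fin n → ℝ) : ℝ := |∑ i, x i| + ∑ l, |GG g x l|

/-- all u functions -/
def uu (F : Finset (Finset (Fin n))) (co : Finset (Fin n) → ℕ) (g : (Fin n → ℝ) → Fin d → ℝ) (l : ℕ) (x y : Fin n → ℝ) : ℝ :=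
  if l = 0 then ∑ i, x i else if h : l - 1 < d then GG g x ⟨l - 1, h⟩ else UU F co (l - 1 - d) x y

/-- all χ functions -/
def xx (F : Finset (Finset (Fin n))) (co : Finset (Fin n) → ℕ) (g : (Fin n → ℝ) → Fin d → ℝ) (m : ℕ) (j : ℕ) (x y : Fin n → ℝ) : ℝ :=
  if j = 0 then ∑ k ∈ Finset.range m, XX F co k x y + (∑ i, x i * y i) * (QQ g x + QQ g y) else XX F co j x y

lemma QQ_neg (g : (Fin n → ℝ) → Fin d → ℝ) (x) : QQ g (-x) = QQ g x := by simp [QQ, GG_neg]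
lemma QQ_nonneg (g : (Fin n → ℝ) → Fin d → ℝ) (x) : 0 ≤ QQ g x := by unfold QQ; positivity
lemma QQ_zero (g : (Fin n → ℝ) → Fin d → ℝ) (x) : QQ g x = 0 ↔ ∑ i, x i = 0 ∧ ∀ l, GG g x l = 0 := by
  unfold QQ
  rw [add_eq_zero_iff_of_nonneg (abs_nonneg _) (Finset.sum_nonneg fun _ _ => abs_nonneg _), abs_eq_zero,
    Finset.sum_eq_zero_iff_of_nonneg (f := fun l => |GG g x l|) (fun _ _ => abs_nonneg _)]
  simp
lemma QQ_cont (g : (Fin n → ℝ) → Fin d → ℝ) (hg : Continuous g) : Continuous (QQ g) := by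
  have := GG_cont g hg
  unfold QQ
  fun_prop

lemma XX_cont (F : Finset (Finset (Fin n))) (co j) : Continuous fun p : (Fin n → ℝ) × (Fin n → ℝ) => XX F co j p.1 p.2 := by
  unfold XX
  exact (((AA_cont F co j _ _ continuous_fst continuous_snd).add (AA_cont F co j _ _ continuous_fst.neg continuous_snd.neg)).sub
    (AA_cont F co j _ _ continuous_fst continuous_snd.neg)).sub (AA_cont F co j _ _ continuous_fst.neg continuous_snd)
lemma UU_cont (F : Finset (Finset (Fin n))) (co j) : Continuous fun p : (Fin n → ℝ) × (Fin n → ℝ) => UU F co j p.1 p.2 := by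
  unfold UU
  exact (((AA_cont F co j _ _ continuous_fst continuous_snd).add (AA_cont F co j _ _ continuous_fst continuous_snd.neg)).sub
    (AA_cont F co j _ _ continuous_fst.neg continuous_snd)).sub (AA_cont F co j _ _ continuous_fst.neg continuous_snd.neg)

lemma XX_neg (F : Finset (Finset (Fin n))) (co j x y) : XX F co j (-x) y = - XX F co j x y := by
  unfold XX; rw [neg_neg]; ring
lemma XX_symm (F : Finset (Finset (Fin n))) (co j x y) : XX F co j y x = XX F co j x y := by
  unfold XX
  rw [AA_symm F co j x y, AA_symm F co j (-x) (-y), AA_symm F co j (-x) y, AA_symm F co j x (-y)]; ring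

lemma four (F : Finset (Finset (Fin n))) (hne : ∀ A ∈ F, A.Nonempty) (co : Finset (Fin n) → ℕ)
    (hco : ∀ G ⊆ F, (∀ A ∈ G, ∀ B ∈ G, A ≠ B → Disjoint A B) → (∀ A ∈ G, ∀ B ∈ G, co A = co B) → G.card < 4)
    (j x y) (h1 : UU F co j x y = 0) (h2 : UU F co j y x = 0) (h3 : XX F co j x y = 0) :
    AA F co j x y = 0 ∧ AA F co j x (-y) = 0 ∧ AA F co j (-x) y = 0 ∧ AA F co j (-x) (-y) = 0 := by
  unfold UU at h1 h2
  unfold XX at h3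
  rw [AA_symm F co j x y, AA_symm F co j (-x) (-y), AA_symm F co j (-x) y, AA_symm F co j x (-y)] at h2
  have hp := AA_nonneg F co j x y
  rcases hp.eq_or_lt with h0 | h0
  · refine ⟨?_, ?_, ?_, ?_⟩ <;> linarith
  exfalso
  obtain ⟨A, hA, cA, A1, A2⟩ := AA_pos F co j x y h0
  obtain ⟨B, hB, cB, B1, B2⟩ := AA_pos F co j x (-y) (by linarith)
  obtain ⟨C, hC, cC, C1, C2⟩ := AA_pos F co j (-x) y (by linarith)
  obtain ⟨D, hD, cD, D1, D2⟩ := AA_pos F co j (-x) (-y) (by linarith)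
  have dx := ps_disj x
  have dy := ps_disj y
  have AB : Disjoint A B := dy.mono A2 B2
  have AC : Disjoint A C := dx.mono A1 C1
  have AD : Disjoint A D := dx.mono A1 D1
  have BC : Disjoint B C := dx.mono B1 C1
  have BD : Disjoint B D := dx.mono B1 D1
  have CD : Disjoint C D := dy.mono C2 D2
  have ne : ∀ X Y : Finset (Fin n), X ∈ F → Disjoint X Y → X ≠ Y := by
    rintro X Y hX h rfl
    obtain ⟨i, hi⟩ := hne X hX
    exact Finset.disjoint_left.1 h hi hi
  have := hco {A, B, C, D} (by simp [Finset.insert_subset_iff, hA, hB, hC, hD]) (by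
    intro X hX Y hY hXY
    simp only [Finset.mem_insert, Finset.mem_singleton] at hX hY
    rcases hX with rfl | rfl | rfl | rfl <;> rcases hY with rfl | rfl | rfl | rfl <;>
      first | exact absurd rfl hXY | assumption | (apply Disjoint.symm; assumption)) (by
    intro X hX Y hY
    simp only [Finset.mem_insert, Finset.mem_singleton] at hX hY
    rcases hX with rfl | rfl | rfl | rfl <;> rcases hY with rfl | rfl | rfl | rfl <;> simp_all)
  rw [Finset.card_insert_of_notMem, Finset.card_insert_of_notMem, Finset.card_insert_of_notMem, Finset.card_singleton] at this
  · omega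
  · simp [ne C D hC CD]
  · simp [ne B C hB BC, ne B D hB BD]
  · simp [ne A B hA AB, ne A C hA AC, ne A D hA AD]

lemma num_case (s : ℕ) (hs : 1 ≤ s) (t : ℤ) (ht : t = -1 ∨ t = 0 ∨ t = 1) (m : ℕ) (hm : (m : ℤ) = 2 ^ s + t) :
    ¬ ∃ α β, NumD m ((m + 1) / 2 : ℕ) α β := by
  rintro ⟨α, β, H⟩
  obtain ⟨r, rfl⟩ : ∃ r, s = r + 1 := ⟨s - 1, by omega⟩
  have e : (2:ℤ)^(r+1) = ((2 * 2^r : ℕ) : ℤ) := by push_cast; ring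
  have hp : 0 < 2^r := by positivity
  rw [e] at hm
  rcases ht with rfl | rfl | rfl
  · refine H.caseA r (by omega) ?_
    have : (m + 1)/2 = 2^r := by omega
    rw [this]; push_cast; rfl
  · refine H.caseB r (by omega) ?_
    have : (m + 1)/2 = 2^r := by omega
    rw [this]; push_cast; rfl
  · rcases r with _ | r
    · refine H.caseA 1 (by omega) ?_
      have : m = 3 := by simp at hm; omega
      subst this; norm_num
    · refine H.caseC (r+1) (by omega) (by omega) ?_
      have : (m + 1)/2 = 2^(r+1) + 1 := by omega
      rw [this]; push_cast; rfl
end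

set_option linter.unusedSimpArgs false
set_option linter.unusedVariables false
/-- **Two interacting Radon pairs.** Let `m = 2^s + t`, `s ≥ 1`, `t ∈ {-1,0,1}`, `d ≥ 1`
and `n ≥ d + ⌈3m/2⌉ + 2`. If `F` is a family of nonempty subsets of `[n]` with
`χ(KG⁴(F)) ≤ m`, then any continuous `f : Δ_{n-1} → ℝ^d` admits two Radon pairs such that
none of the four mutual intersections contains a member of `F`. -/
theorem two_radon_pairs (s : ℕ) (hs : 1 ≤ s) (t : ℤ)
    (ht : t = -1 ∨ t = 0 ∨ t = 1) (m : ℕ) (hm : (m : ℤ) = 2 ^ s + t)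
    (d n : ℕ) (hd : 1 ≤ d) (hn : d + (3 * m + 1) / 2 + 2 ≤ n)
    (F : Finset (Finset (Fin n))) (hne : ∀ A ∈ F, A.Nonempty)
    (hχ : KneserChromaticLe F 4 m)
    (f : (Fin n → ℝ) → EuclideanSpace ℝ (Fin d))
    (hf : ContinuousOn f (stdSimplex ℝ (Fin n))) :
    ∃ σp σm τp τm : Finset (Fin n),
      IsRadonPair f σp σm ∧ IsRadonPair f τp τm ∧
      (∀ A ∈ F, ¬A ⊆ σp ∩ τp) ∧ (∀ A ∈ F, ¬A ⊆ σp ∩ τm) ∧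
      (∀ A ∈ F, ¬A ⊆ σm ∩ τp) ∧ (∀ A ∈ F, ¬A ⊆ σm ∩ τm) := by
  by_contra hcon
  obtain ⟨c, hc⟩ := hχ
  obtain ⟨g, hgc, hg⟩ := ext_exists f hf
  have hm0 : 0 < m := by
    have : (2:ℤ)^1 ≤ 2^s := pow_le_pow_right₀ (by norm_num) hs
    omega
  have hco : ∀ G ⊆ F, (∀ A ∈ G, ∀ B ∈ G, A ≠ B → Disjoint A B) →
      (∀ A ∈ G, ∀ B ∈ G, (c A : ℕ) = (c B : ℕ)) → G.card < 4 :=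
    fun G h1 h2 h3 => hc G h1 h2 fun A hA B hB => Fin.ext (h3 A hA B hB)
  let co : Finset (Fin n) → ℕ := fun A => (c A : ℕ)
  have hcolt : ∀ A, co A < m := fun A => (c A).2
  -- no common zero
  have nosol : ∀ x ∈ Sph n, ∀ y ∈ Sph n, QQ g x = 0 → QQ g y = 0 →
      (∀ j < m, AA F co j x y = 0 ∧ AA F co j x (-y) = 0 ∧ AA F co j (-x) y = 0 ∧ AA F co j (-x) (-y) = 0) → False := by
    intro x hx y hy qx qy h
    rw [QQ_zero] at qx qy
    exact hcon ⟨ps x, ps (-x), ps y, ps (-y), radon_of f g hg x hx qx.1 qx.2, radon_of f g hg y hy qy.1 qy.2,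
      AA_zero F co x y fun A _ => (h _ (hcolt A)).1,
      AA_zero F co x (-y) fun A _ => (h _ (hcolt A)).2.1,
      AA_zero F co (-x) y fun A _ => (h _ (hcolt A)).2.2.1,
      AA_zero F co (-x) (-y) fun A _ => (h _ (hcolt A)).2.2.2⟩
  refine top_main n (d + 1 + m) m ((m + 1) / 2) (by omega) (num_case s hs t ht m hm) hm0
    (uu F co g) (xx F co g m) ?_ ?_ ?_ ?_ ?_ ?_ ?_ ?_
  · intro l _
    unfold uu
    split_ifs with h h'
    · fun_prop
    · exact (continuous_apply _).comp ((GG_cont g hgc).comp continuous_fst)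
    · exact UU_cont F co _
  · intro j _
    unfold xx
    split_ifs with h
    · refine (continuous_finsetSum _ fun k _ => XX_cont F co k).add (Continuous.mul (by fun_prop) ?_)
      exact ((QQ_cont g hgc).comp continuous_fst).add ((QQ_cont g hgc).comp continuous_snd)
    · exact XX_cont F co j
  · intro l x y
    unfold uu
    split_ifs with h h'
    · simp
    · rw [GG_neg]; rfl
    · unfold UU; rw [neg_neg]; ring
  · intro l x y
    unfold uu
    split_ifs with h h'
    · rfl
    · rfl
    · unfold UU; rw [neg_neg]; ring
  · intro j x y
    unfold xx
    split_ifs with h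
    · simp only [XX_neg, QQ_neg, Finset.sum_neg_distrib, Pi.neg_apply, neg_mul]; ring
    · exact XX_neg F co j x y
  · intro j x y
    unfold xx
    split_ifs with h
    · simp only [XX_symm F co _ x y, mul_comm (y _), add_comm (QQ g y)]
    · exact XX_symm F co j x y
  · intro x hx y hy
    by_contra hno
    push Not at hno
    obtain ⟨hu, hx0⟩ := hno
    have q1 : QQ g x = 0 := by
      rw [QQ_zero]
      refine ⟨?_, fun l => ?_⟩
      · have := (hu 0 (by omega)).1; simpa [uu] using this
      · have := (hu (l+1) (by omega)).1; simpa [uu] using this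
    have q2 : QQ g y = 0 := by
      rw [QQ_zero]
      refine ⟨?_, fun l => ?_⟩
      · have := (hu 0 (by omega)).2; simpa [uu] using this
      · have := (hu (l+1) (by omega)).2; simpa [uu] using this
    have hX1 : ∀ j < m, j ≠ 0 → XX F co j x y = 0 := by
      intro j hj h0
      have := hx0 j hj
      simpa [xx, h0] using this
    have hX0 : XX F co 0 x y = 0 := by
      have := hx0 0 hm0
      rw [xx, if_pos rfl, q1, q2, add_zero, mul_zero, add_zero, Finset.sum_eq_single_of_mem 0 (by simpa using hm0)] at this
      · exact this
      · intro j hj h0; exact hX1 j (by simpa using hj) h0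
    refine nosol x hx y hy q1 q2 fun j hj => four F hne co hco j x y ?_ ?_ ?_
    · have := (hu (j + d + 1) (by omega)).1; simpa [uu] using this
    · have := (hu (j + d + 1) (by omega)).2; simpa [uu] using this
    · by_cases h : j = 0
      · subst h; exact hX0
      · exact hX1 j hj h
  · intro x hx
    have hXX : ∀ j, XX F co j x x = AA F co j x x + AA F co j (-x) (-x) := by
      intro j
      unfold XX
      rw [AA_symm F co j x (-x), AA_self F hne]; ring
    have hXn : ∀ j, 0 ≤ XX F co j x x := fun j => by rw [hXX]; exact add_nonneg (AA_nonneg _ _ _ _ _) (AA_nonneg _ _ _ _ _)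
    have hsum : 0 ≤ ∑ k ∈ Finset.range m, XX F co k x x := Finset.sum_nonneg fun k _ => hXn k
    have hsq : 0 < ∑ i, x i * x i := by
      have h0 : 0 ≤ ∑ i, x i * x i := Finset.sum_nonneg fun i _ => mul_self_nonneg _
      refine lt_of_le_of_ne h0 fun h => ?_
      rw [eq_comm, Finset.sum_eq_zero_iff_of_nonneg fun i _ => mul_self_nonneg _] at h
      have hx1 : ∑ i, |x i| = 1 := hx
      rw [Finset.sum_eq_zero] at hx1
      · exact zero_ne_one hx1
      · intro i hi; simpa using h i hi
    have hQ := QQ_nonneg g x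
    rw [xx, if_pos rfl]
    have hprod : 0 ≤ (∑ i, x i * x i) * (QQ g x + QQ g x) := by positivity
    refine lt_of_le_of_ne (by linarith) fun h => ?_
    have hp0 : (∑ i, x i * x i) * (QQ g x + QQ g x) = 0 := by linarith
    have hs0 : ∑ k ∈ Finset.range m, XX F co k x x = 0 := by linarith
    have hQ0 : QQ g x = 0 := by
      have := (mul_eq_zero.1 hp0).resolve_left hsq.ne'
      linarith
    rw [Finset.sum_eq_zero_iff_of_nonneg fun k _ => hXn k] at hs0
    refine nosol x hx x hx hQ0 hQ0 fun j hj => ?_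
    have h1 := hs0 j (by simpa using hj)
    rw [hXX] at h1
    have h2 := AA_nonneg F co j x x
    have h3 := AA_nonneg F co j (-x) (-x)
    exact ⟨by linarith, AA_self F hne co j x, by rw [AA_symm]; exact AA_self F hne co j x, by linarith⟩
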